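/- arXiv:0906.2685 — 2 statements merged into one kernel-verified Lean document; each statement's English description precedes it below -/
import Mathlib

section
/- For every v ∈ D(G) the limit â(v) := lim_{t→0⁺} (1/t) Σ_{n=0}^{∞} a(∫₀ᵗ V_n(s)v ds) exists, and |â(v)| ≤ 4M(‖v‖ + ‖Gv‖). Furthermore, for every v ∈ D(G) ∩ X₊ one has â(v) ≤ a₀(v) ≤ ‖Gv‖. -/
open Filter Topology Set MeasureTheory

noncomputable section

variable {X : Type*} [NormedAddCommGroup X] [NormedSpace ℝ X] [CompleteSpace X] [PartialOrder X]

/-- A `C₀`-semigroup on `X` (strong continuity required on `[0,∞)`). -/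
structure IsC0Semigroup (T : ℝ → X →L[ℝ] X) : Prop where
  map_zero : T 0 = ContinuousLinearMap.id ℝ X
  map_add : ∀ s t : ℝ, 0 ≤ s → 0 ≤ t → T (s + t) = (T s).comp (T t)
  strongCont : ∀ u : X, ContinuousOn (fun t => T t u) (Ici (0 : ℝ))

/-- A substochastic `C₀`-semigroup: positive and contracting on the positive cone. -/
def IsSubstochastic (T : ℝ → X →L[ℝ] X) : Prop :=
  IsC0Semigroup T ∧ ∀ t : ℝ, 0 ≤ t → ∀ u : X, 0 ≤ u → 0 ≤ T t u ∧ ‖T t u‖ ≤ ‖u‖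

/-- `G` is the infinitesimal generator of the semigroup `T`. -/
def IsGeneratorOf (G : X →ₗ.[ℝ] X) (T : ℝ → X →L[ℝ] X) : Prop :=
  (∀ u : X, u ∈ G.domain ↔
    ∃ v : X, Tendsto (fun t : ℝ => t⁻¹ • (T t u - u)) (𝓝[>] 0) (𝓝 v)) ∧
  ∀ u : G.domain, Tendsto (fun t : ℝ => t⁻¹ • (T t (u : X) - (u : X))) (𝓝[>] 0) (𝓝 (G u))

/-- The bounded operator `B(λ - A)⁻¹`, given the resolvent `R = (λ - A)⁻¹` of `A`. -/
def Jfun (A : X →ₗ.[ℝ] X) (B : A.domain →ₗ[ℝ] X) (R : X →L[ℝ] X)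
    (hdom : ∀ u : X, R u ∈ A.domain) : X → X :=
  fun u => B ⟨R u, hdom u⟩

/-- The functional `a(u) = -⟨Ψ, (A+B)u⟩` on `D(A)`. -/
def aFun (Ψ : X →L[ℝ] ℝ) (A : X →ₗ.[ℝ] X) (B : A.domain →ₗ[ℝ] X) (w : A.domain) : ℝ :=
  -Ψ (A w + B w)

/-- The value `ā((λ-G)⁻¹u) = Σₙ a((λ-A)⁻¹[B(λ-A)⁻¹]ⁿ u)`, expressed through the
resolvent `R = (λ-A)⁻¹` of `A`. -/
def abarRes (Ψ : X →L[ℝ] ℝ) (A : X →ₗ.[ℝ] X) (B : A.domain →ₗ[ℝ] X)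
    (R : X →L[ℝ] X) (hdom : ∀ u : X, R u ∈ A.domain) (u : X) : ℝ :=
  ∑' n : ℕ, aFun Ψ A B ⟨R ((Jfun A B R hdom)^[n] u), hdom _⟩

/-- `⟨Ξ_λ, u⟩ = a₀((λ-G)⁻¹u) - ā((λ-G)⁻¹u)`, where `RA = (λ-A)⁻¹`, `RG = (λ-G)⁻¹` and
`a₀(v) = -⟨Ψ, G v⟩`. -/
def xiRes (Ψ : X →L[ℝ] ℝ) (A : X →ₗ.[ℝ] X) (B : A.domain →ₗ[ℝ] X) (G : X →ₗ.[ℝ] X)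
    (RA RG : X →L[ℝ] X) (hAdom : ∀ u : X, RA u ∈ A.domain)
    (hGdom : ∀ u : X, RG u ∈ G.domain) (u : X) : ℝ :=
  (-(Ψ (G ⟨RG u, hGdom u⟩))) - abarRes Ψ A B RA hAdom u

/-- The functional `ā` on `D(G)`: `ā(v) = ā((λ-G)⁻¹ u)` for `u = λ v - G v`
(written through the resolvent `R = (λ-A)⁻¹`). -/
def abarOn (Ψ : X →L[ℝ] ℝ) (A : X →ₗ.[ℝ] X) (B : A.domain →ₗ[ℝ] X) (G : X →ₗ.[ℝ] X)
    (R : X →L[ℝ] X) (hdom : ∀ u : X, R u ∈ A.domain) (l : ℝ) (v : G.domain) : ℝ :=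
  abarRes Ψ A B R hdom (l • (v : X) - G v)

/-- `v` belongs to the domain of the closure of `(A + B, D(A))` (together with a limit of
the corresponding values). -/
def InClosureDomain (A : X →ₗ.[ℝ] X) (B : A.domain →ₗ[ℝ] X) (v : X) : Prop :=
  ∃ (f : ℕ → A.domain) (w : X),
    Tendsto (fun n => ((f n : X))) atTop (𝓝 v) ∧
    Tendsto (fun n => A (f n) + B (f n)) atTop (𝓝 w)

set_option linter.unusedSectionVars false
structure IsCC (K : Set X) : Prop where
  closed : IsClosed K
  zero : (0 : X) ∈ K
  add : ∀ u ∈ K, ∀ v ∈ K, u + v ∈ K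
  smul : ∀ c : ℝ, 0 ≤ c → ∀ u ∈ K, c • u ∈ K

lemma IsCC.integral_mem {K : Set X} (hK : IsCC K) {α : Type*} [MeasurableSpace α]
    (μ : Measure α) (f : α → X) (hf : ∀ᵐ x ∂μ, f x ∈ K) : ∫ x, f x ∂μ ∈ K := by
  by_cases hi : Integrable f μ
  swap
  · rw [integral_undef hi]; exact hK.zero
  by_contra hx
  have hconv : Convex ℝ K := by
    intro x hx y hy a b ha hb _
    exact hK.add _ (hK.smul a ha x hx) _ (hK.smul b hb y hy)
  obtain ⟨g, c, h1, h2⟩ := geometric_hahn_banach_closed_point hconv hK.closed hx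
  have hc : 0 < c := by simpa using h1 0 hK.zero
  have hneg : ∀ k ∈ K, g k ≤ 0 := by
    intro k hk
    by_contra hpos
    push Not at hpos
    have := h1 ((c / g k) • k) (hK.smul _ (by positivity) k hk)
    rw [map_smul, smul_eq_mul, div_mul_cancel₀ _ hpos.ne'] at this
    exact lt_irrefl _ this
  rw [← g.integral_comp_comm hi] at h2
  have : ∫ x, g (f x) ∂μ ≤ 0 := integral_nonpos_of_ae (by
    filter_upwards [hf] with x hx using hneg _ hx)
  linarith

lemma IsCC.interval_mem {K : Set X} (hK : IsCC K) {a b : ℝ} (hab : a ≤ b) (f : ℝ → X)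
    (hf : ∀ x ∈ Ioc a b, f x ∈ K) : ∫ x in a..b, f x ∈ K := by
  rw [intervalIntegral.integral_of_le hab]
  apply hK.integral_mem
  exact (ae_restrict_iff' measurableSet_Ioc).2 (Eventually.of_forall hf)

lemma IsCC.sum {K : Set X} (hK : IsCC K) {ι : Type*} (s : Finset ι) (f : ι → X)
    (hf : ∀ i ∈ s, f i ∈ K) : ∑ i ∈ s, f i ∈ K := by
  classical
  induction s using Finset.induction_on with
  | empty => simpa using hK.zero
  | insert a s ha ih =>
    rw [Finset.sum_insert ha]
    exact hK.add _ (hf _ (by simp)) _ (ih fun i hi => hf i (by simp [hi]))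

lemma strong_joint (T : ℝ → X →L[ℝ] X) (hT : ∀ u : X, ContinuousOn (fun t => T t u) (Ici (0 : ℝ))) :
    ContinuousOn (fun p : ℝ × X => T p.1 p.2) (Ici (0 : ℝ) ×ˢ univ) := by
  rintro ⟨t, u⟩ ⟨ht, -⟩
  have ht : 0 ≤ t := ht
  obtain ⟨C, hC⟩ : ∃ C, ∀ i : Icc (0 : ℝ) (t + 1), ‖T i‖ ≤ C := by
    apply banach_steinhaus
    intro x
    obtain ⟨C, hC⟩ := isCompact_Icc.exists_bound_of_continuousOn
      ((hT x).mono (Icc_subset_Ici_self : Icc (0 : ℝ) (t + 1) ⊆ Ici 0))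
    exact ⟨C, fun i => hC i i.2⟩
  have h1 : Tendsto (fun p : ℝ × X => T p.1 u) (𝓝[Ici (0 : ℝ) ×ˢ univ] (t, u)) (𝓝 (T t u)) := by
    refine ((hT u) t ht).tendsto.comp ?_
    rw [nhdsWithin_prod_eq]
    exact tendsto_fst
  have h2 : Tendsto (fun p : ℝ × X => T p.1 (p.2 - u)) (𝓝[Ici (0 : ℝ) ×ˢ univ] (t, u)) (𝓝 0) := by
    have h3 : Tendsto (fun p : ℝ × X => C * ‖p.2 - u‖) (𝓝[Ici (0 : ℝ) ×ˢ univ] (t, u)) (𝓝 0) := by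
      have : Continuous (fun p : ℝ × X => C * ‖p.2 - u‖) := by fun_prop
      have := (this.tendsto (t, u)).mono_left
        (nhdsWithin_le_nhds (s := Ici (0 : ℝ) ×ˢ (univ : Set X)))
      simpa using this
    refine squeeze_zero_norm' ?_ h3
    have h4 : ∀ᶠ p : ℝ × X in 𝓝[Ici (0 : ℝ) ×ˢ univ] (t, u), p.1 < t + 1 := by
      apply nhdsWithin_le_nhds
      exact (continuous_fst.tendsto (t, u)).eventually (gt_mem_nhds (by simp))
    filter_upwards [h4, self_mem_nhdsWithin] with p hp hp2
    exact ((T p.1).le_opNorm _).trans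
      (mul_le_mul_of_nonneg_right (hC ⟨p.1, hp2.1, hp.le⟩) (norm_nonneg _))
  have := h1.add h2
  simp only [map_sub, add_sub_cancel, add_zero] at this
  exact this

lemma strong_comp (T : ℝ → X →L[ℝ] X) (hT : ∀ u : X, ContinuousOn (fun t => T t u) (Ici (0 : ℝ)))
    {α : Type*} [TopologicalSpace α] {s : Set α} (f : α → ℝ) (g : α → X)
    (hf : ContinuousOn f s) (hg : ContinuousOn g s) (h0 : ∀ x ∈ s, 0 ≤ f x) :
    ContinuousOn (fun x => T (f x) (g x)) s :=
  (strong_joint T hT).comp (hf.prodMk hg) (fun x hx => ⟨h0 x hx, trivial⟩)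

lemma strong_tendsto (T : ℝ → X →L[ℝ] X)
    (hT : ∀ u : X, ContinuousOn (fun t => T t u) (Ici (0 : ℝ)))
    {α : Type*} {l : Filter α} (f : α → ℝ) (g : α → X) {t : ℝ} {u : X} (ht : 0 ≤ t)
    (hf : Tendsto f l (𝓝 t)) (hg : Tendsto g l (𝓝 u)) (h0 : ∀ᶠ x in l, 0 ≤ f x) :
    Tendsto (fun x => T (f x) (g x)) l (𝓝 (T t u)) := by
  have h1 := strong_joint T hT (t, u) ⟨ht, trivial⟩
  refine h1.tendsto.comp (tendsto_nhdsWithin_iff.2 ⟨hf.prodMk_nhds hg, ?_⟩)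
  filter_upwards [h0] with x hx using ⟨hx, trivial⟩

lemma hasRight {f : ℝ → X} {x : ℝ} {d : X}
    (h : Tendsto (fun t : ℝ => t⁻¹ • (f (x + t) - f x)) (𝓝[>] 0) (𝓝 d)) :
    HasDerivWithinAt f d (Ioi x) x := by
  rw [hasDerivWithinAt_iff_tendsto_slope' (by simp)]
  have h1 : Tendsto (fun y : ℝ => y - x) (𝓝[>] x) (𝓝[>] 0) := by
    refine tendsto_nhdsWithin_iff.2 ⟨?_, ?_⟩
    · have : Continuous (fun y : ℝ => y - x) := by fun_prop
      have := (this.tendsto x).mono_left (nhdsWithin_le_nhds (s := Ioi x))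
      simpa using this
    · filter_upwards [self_mem_nhdsWithin] with y hy
      simpa using hy
  have h2 := h.comp h1
  refine h2.congr fun y => ?_
  simp [slope, Function.comp]

section gen
variable {T : ℝ → X →L[ℝ] X} {H : X →ₗ.[ℝ] X}

lemma gen_of_tendsto (hH : IsGeneratorOf H T) {x y : X}
    (h : Tendsto (fun t : ℝ => t⁻¹ • (T t x - x)) (𝓝[>] 0) (𝓝 y)) :
    ∃ hx : x ∈ H.domain, H ⟨x, hx⟩ = y := by
  have hx : x ∈ H.domain := (hH.1 x).2 ⟨y, h⟩
  exact ⟨hx, tendsto_nhds_unique (hH.2 ⟨x, hx⟩) h⟩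

lemma gen_right (hT : IsC0Semigroup T) (hH : IsGeneratorOf H T) (u : H.domain) {s : ℝ}
    (hs : 0 ≤ s) : Tendsto (fun h : ℝ => h⁻¹ • (T (s + h) u - T s u)) (𝓝[>] 0) (𝓝 (T s (H u))) := by
  have := ((T s).continuous.tendsto _).comp (hH.2 u)
  refine this.congr' ?_
  filter_upwards [self_mem_nhdsWithin] with h hh
  simp [hT.map_add s h hs (le_of_lt hh)]

lemma gen_invariant (hT : IsC0Semigroup T) (hH : IsGeneratorOf H T) (u : H.domain) {s : ℝ}
    (hs : 0 ≤ s) : ∃ h : T s u ∈ H.domain, H ⟨T s u, h⟩ = T s (H u) := by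
  apply gen_of_tendsto hH
  refine (gen_right hT hH u hs).congr' ?_
  filter_upwards [self_mem_nhdsWithin] with h hh
  rw [add_comm, hT.map_add h s (le_of_lt hh) hs]
  simp

lemma gen_int (hT : IsC0Semigroup T) (hH : IsGeneratorOf H T) (u : H.domain) {t : ℝ}
    (ht : 0 ≤ t) : ∫ s in (0:ℝ)..t, T s (H u) = T t u - u := by
  have := intervalIntegral.integral_eq_sub_of_hasDeriv_right_of_le (f := fun s => T s (u : X))
    (f' := fun s => T s (H u)) ht ((hT.strongCont u).mono Icc_subset_Ici_self)
    (fun x hx => hasRight (gen_right hT hH u hx.1.le))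
    (((hT.strongCont (H u)).mono Icc_subset_Ici_self).intervalIntegrable_of_Icc ht)
  simpa [hT.map_zero] using this

lemma cont_max (hT : ∀ u : X, ContinuousOn (fun t => T t u) (Ici (0 : ℝ))) (u : X) :
    Continuous (fun s : ℝ => T (max s 0) u) :=
  (hT u).comp_continuous (by fun_prop) (fun x => mem_Ici.2 (le_max_right _ _))

lemma int_max (u : X) {t : ℝ} (ht : 0 ≤ t) :
    ∫ s in (0:ℝ)..t, T s u = ∫ s in (0:ℝ)..t, T (max s 0) u := by
  apply intervalIntegral.integral_congr
  intro s hs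
  rw [uIcc_of_le ht] at hs
  simp [max_eq_left hs.1]

lemma int_deriv (hT : ∀ u : X, ContinuousOn (fun t => T t u) (Ici (0 : ℝ))) (u : X) (t : ℝ) :
    Tendsto (fun h : ℝ => h⁻¹ • ((∫ s in (0:ℝ)..(t + h), T (max s 0) u) -
      (∫ s in (0:ℝ)..t, T (max s 0) u))) (𝓝[>] 0) (𝓝 (T (max t 0) u)) := by
  have h1 : HasDerivAt (fun t => ∫ s in (0:ℝ)..t, T (max s 0) u) (T (max t 0) u) t :=
    ((cont_max hT u).integral_hasStrictDerivAt 0 t).hasDerivAt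
  have h2 := hasDerivAt_iff_tendsto_slope_zero.1 h1
  exact h2.mono_left (nhdsWithin_mono _ (fun x hx => ne_of_gt hx))

lemma gen_int_mem (hT : IsC0Semigroup T) (hH : IsGeneratorOf H T) (u : X) {t : ℝ}
    (ht : 0 ≤ t) : ∃ h : (∫ s in (0:ℝ)..t, T s u) ∈ H.domain,
      H ⟨∫ s in (0:ℝ)..t, T s u, h⟩ = T t u - u := by
  apply gen_of_tendsto hH
  have h1 := (int_deriv hT.strongCont u t).sub (int_deriv hT.strongCont u 0)
  simp only [max_eq_left ht, max_self, hT.map_zero, zero_add, ContinuousLinearMap.id_apply,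
    intervalIntegral.integral_same, sub_zero] at h1
  refine h1.congr' ?_
  filter_upwards [self_mem_nhdsWithin] with h hh
  have hh : 0 < h := hh
  rw [← smul_sub]
  congr 1
  have hint : ∀ a b : ℝ, IntervalIntegrable (fun s => T (max s 0) u) volume a b :=
    fun a b => (cont_max hT.strongCont u).intervalIntegrable a b
  have e1 : T h (∫ s in (0:ℝ)..t, T s u) = ∫ s in (0:ℝ)..t, T (max (s + h) 0) u := by
    rw [← (T h).intervalIntegral_comp_comm
      (((hT.strongCont u).mono Icc_subset_Ici_self).intervalIntegrable_of_Icc ht)]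
    apply intervalIntegral.integral_congr
    intro s hs
    rw [uIcc_of_le ht] at hs
    have : 0 ≤ s + h := by linarith [hs.1]
    simp only [max_eq_left this]
    rw [add_comm, hT.map_add h s hh.le hs.1]; rfl
  have e2 := int_max (T := T) u ht
  rw [e1, e2, intervalIntegral.integral_comp_add_right (fun s => T (max s 0) u), zero_add,
    ← intervalIntegral.integral_add_adjacent_intervals (hint 0 h) (hint h (t + h))]
  abel

lemma gen_closed (hT : IsC0Semigroup T) (hH : IsGeneratorOf H T) (f : ℕ → H.domain) (x y : X)
    (hx : Tendsto (fun n => (f n : X)) atTop (𝓝 x)) (hy : Tendsto (fun n => H (f n)) atTop (𝓝 y)) :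
    ∃ h : x ∈ H.domain, H ⟨x, h⟩ = y := by
  apply gen_of_tendsto hH
  have key : ∀ t : ℝ, 0 ≤ t → ∫ s in (0:ℝ)..t, T s y = T t x - x := by
    intro t ht
    obtain ⟨C, hC⟩ : ∃ C, ∀ i : Icc (0 : ℝ) t, ‖T i‖ ≤ C := by
      apply banach_steinhaus
      intro x
      obtain ⟨C, hC⟩ := isCompact_Icc.exists_bound_of_continuousOn
        ((hT.strongCont x).mono (Icc_subset_Ici_self : Icc (0 : ℝ) t ⊆ Ici 0))
      exact ⟨C, fun i => hC i i.2⟩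
    have h1 : Tendsto (fun n => T t (f n) - (f n : X)) atTop (𝓝 (T t x - x)) :=
      (((T t).continuous.tendsto _).comp hx).sub hx
    refine tendsto_nhds_unique ?_ h1
    have hint : ∀ u, IntervalIntegrable (fun s => T s u) volume 0 t := fun u =>
      (((hT.strongCont u).mono Icc_subset_Ici_self).intervalIntegrable_of_Icc ht)
    rw [tendsto_iff_norm_sub_tendsto_zero]
    have h3 : Tendsto (fun n => C * ‖H (f n) - y‖ * |t - 0|) atTop (𝓝 0) := by
      have := ((tendsto_iff_norm_sub_tendsto_zero.1 hy).const_mul C).mul_const |t - 0|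
      simpa using this
    refine squeeze_zero (fun n => norm_nonneg _) (fun n => ?_) h3
    rw [← gen_int hT hH (f n) ht, ← intervalIntegral.integral_sub (hint _) (hint _)]
    apply intervalIntegral.norm_integral_le_of_norm_le_const
    intro s hs
    rw [uIoc_of_le ht] at hs
    rw [← map_sub]
    exact ((T s).le_opNorm _).trans
      (mul_le_mul_of_nonneg_right (hC ⟨s, hs.1.le, hs.2⟩) (norm_nonneg _))
  have h1 := int_deriv hT.strongCont y 0
  simp only [max_self, hT.map_zero, zero_add, ContinuousLinearMap.id_apply,
    intervalIntegral.integral_same, sub_zero] at h1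
  refine h1.congr' ?_
  filter_upwards [self_mem_nhdsWithin] with h hh
  rw [← int_max y (le_of_lt hh), key h (le_of_lt hh)]

end gen
lemma B_cont {U V : ℝ → X →L[ℝ] X} {A G : X →ₗ.[ℝ] X} (hU : IsC0Semigroup U)
    (hV : IsC0Semigroup V) (hA : IsGeneratorOf A U) (hG : IsGeneratorOf G V)
    (B : A.domain →ₗ[ℝ] X)
    (hGext : ∀ u : A.domain, ∃ h : (u : X) ∈ G.domain, G ⟨(u : X), h⟩ = A u + B u)
    {α : Type*} [TopologicalSpace α] (f : α → A.domain) (hf : Continuous (fun x => (f x : X)))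
    (hAf : Continuous (fun x => A (f x))) : Continuous (fun x => B (f x)) := by
  have hmem : ∀ p : A.graph, p.1.1 ∈ A.domain := fun p => LinearPMap.mem_domain_of_mem_graph p.2
  have hval : ∀ p : A.graph, A ⟨p.1.1, hmem p⟩ = p.1.2 := by
    intro p
    obtain ⟨y, h1, h2⟩ := (LinearPMap.mem_graph_iff A).1 p.2
    rw [← h2]; congr 1; exact Subtype.ext h1.symm
  have hcl : IsClosed (A.graph : Set (X × X)) := by
    apply IsSeqClosed.isClosed
    rintro φ ⟨x, y⟩ hφ hlim
    obtain ⟨h, e⟩ := gen_closed hU hA (fun n => ⟨(φ n).1, hmem ⟨φ n, hφ n⟩⟩) x y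
      ((continuous_fst.tendsto _).comp hlim)
      (((continuous_snd.tendsto _).comp hlim).congr (fun n => (hval ⟨φ n, hφ n⟩).symm))
    exact (LinearPMap.mem_graph_iff A).2 ⟨⟨x, h⟩, rfl, e⟩
  have : CompleteSpace A.graph := completeSpace_coe_iff_isComplete.mpr hcl.isComplete
  let g : A.graph →ₗ[ℝ] X :=
    { toFun := fun p => B ⟨p.1.1, hmem p⟩
      map_add' := fun p q => by rw [← map_add]; rfl
      map_smul' := fun c p => by rw [RingHom.id_apply, ← map_smul]; rfl }
  have hg : Continuous g := by
    apply LinearMap.continuous_of_seq_closed_graph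
    intro p x y hp hgp
    have hp' := (continuous_subtype_val.tendsto x).comp hp
    have hp1 := (continuous_fst.tendsto _).comp hp'
    have hp2 := (continuous_snd.tendsto _).comp hp'
    obtain ⟨h, e⟩ := gen_closed hV hG
      (fun n => ⟨(p n).1.1, (hGext ⟨_, hmem (p n)⟩).choose⟩) x.1.1 (x.1.2 + y) hp1 (by
        refine (hp2.add hgp).congr fun n => ?_
        rw [(hGext ⟨_, hmem (p n)⟩).choose_spec, hval]; rfl)
    obtain ⟨h', e'⟩ := hGext ⟨_, hmem x⟩
    have : x.1.2 + y = x.1.2 + g x := by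
      rw [← e, e', hval]; rfl
    exact add_left_cancel this
  have hm : ∀ x, ((f x : X), A (f x)) ∈ A.graph := fun x => LinearPMap.mem_graph A (f x)
  have : Continuous (fun x => (⟨((f x : X), A (f x)), hm x⟩ : A.graph)) :=
    (hf.prodMk hAf).subtype_mk _
  exact hg.comp this

section ctx
variable {U V : ℝ → X →L[ℝ] X} {A G : X →ₗ.[ℝ] X} {B : A.domain →ₗ[ℝ] X}

lemma BU_cont (hU : IsC0Semigroup U)
    (hV : IsC0Semigroup V) (hA : IsGeneratorOf A U) (hG : IsGeneratorOf G V)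
    (hGext : ∀ u : A.domain, ∃ h : (u : X) ∈ G.domain, G ⟨(u : X), h⟩ = A u + B u)
    (hUdom : ∀ (s : ℝ), 0 ≤ s → ∀ u : A.domain, U s (u : X) ∈ A.domain) (u : A.domain) :
    Continuous (fun s : ℝ =>
      B ⟨U (max s 0) (u : X), hUdom (max s 0) (le_max_right _ _) u⟩) := by
  apply B_cont hU hV hA hG B hGext
    (fun s => ⟨U (max s 0) (u : X), hUdom (max s 0) (le_max_right _ _) u⟩)
  · exact cont_max hU.strongCont u
  · refine (cont_max hU.strongCont (A u)).congr fun s => ?_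
    obtain ⟨h, e⟩ := gen_invariant hU hA u (s := max s 0) (le_max_right _ _)
    exact e.symm

lemma duhamel (hU : IsC0Semigroup U)
    (hV : IsC0Semigroup V) (hA : IsGeneratorOf A U) (hG : IsGeneratorOf G V)
    (hGext : ∀ u : A.domain, ∃ h : (u : X) ∈ G.domain, G ⟨(u : X), h⟩ = A u + B u)
    (hUdom : ∀ (s : ℝ), 0 ≤ s → ∀ u : A.domain, U s (u : X) ∈ A.domain) (u : A.domain)
    {t : ℝ} (ht : 0 ≤ t) :
    V t u - U t u = ∫ s in (0:ℝ)..t,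
      V (t - s) (B ⟨U (max s 0) (u : X), hUdom (max s 0) (le_max_right _ _) u⟩) := by
  have hc := BU_cont hU hV hA hG hGext hUdom u
  have h1 := intervalIntegral.integral_eq_sub_of_hasDeriv_right_of_le
    (f := fun s => V (t - s) (U s u))
    (f' := fun s => -V (t - s) (B ⟨U (max s 0) (u : X), hUdom (max s 0) (le_max_right _ _) u⟩)) ht
    (strong_comp V hV.strongCont _ _ (by fun_prop)
      ((hU.strongCont u).mono Icc_subset_Ici_self) (fun x hx => by linarith [hx.2]))
    (fun s hs => by
      apply hasRight
      have hs0 : max s 0 = s := max_eq_left hs.1.le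
      let y : A.domain := ⟨U s u, hUdom s hs.1.le u⟩
      obtain ⟨hy, ey⟩ := hGext y
      have l1 := (hA.2 y).sub (hG.2 ⟨y, hy⟩)
      rw [ey] at l1
      have l2 := strong_tendsto V hV.strongCont (l := 𝓝[>] 0) (fun h : ℝ => t - s - h) _
        (t := t - s) (by linarith [hs.2]) (by
          have : Continuous (fun h : ℝ => t - s - h) := by fun_prop
          simpa using (this.tendsto 0).mono_left (nhdsWithin_le_nhds (s := Ioi 0))) l1 (by
          apply nhdsWithin_le_nhds
          filter_upwards [gt_mem_nhds (show (0:ℝ) < t - s by linarith [hs.2])] with h hh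
          linarith)
      have e3 : V (t - s) (A y - (A y + B y)) =
          -V (t - s) (B ⟨U (max s 0) (u : X), hUdom (max s 0) (le_max_right _ _) u⟩) := by
        rw [sub_add_cancel_left, map_neg]
        congr 4
        exact Subtype.ext (by simp [y, hs0])
      rw [← e3]
      refine l2.congr' ?_
      have : ∀ᶠ h : ℝ in 𝓝[>] 0, h < t - s := by
        apply nhdsWithin_le_nhds
        exact gt_mem_nhds (show (0:ℝ) < t - s by linarith [hs.2])
      filter_upwards [this, self_mem_nhdsWithin] with h hh hh0
      have hh0 : 0 < h := hh0
      rw [← smul_sub, map_smul]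
      congr 1
      have e4 : V (t - s) (U s u) = V (t - s - h) (V h (U s u)) := by
        have := hV.map_add (t - s - h) h (by linarith) hh0.le
        rw [sub_add_cancel] at this
        rw [this]; rfl
      have e5 : U (s + h) u = U h (U s u) := by
        rw [add_comm, hU.map_add h s hh0.le hs.1.le]; rfl
      rw [e4, e5, ← sub_sub, ← map_sub]
      congr 1
      simp only [y]
      abel)
    (((strong_comp V hV.strongCont _ _ (by fun_prop) hc.continuousOn
      (fun x hx => by linarith [hx.2])).neg).intervalIntegrable_of_Icc ht)
  rw [intervalIntegral.integral_neg] at h1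
  simp only [sub_self, sub_zero, hU.map_zero, hV.map_zero, ContinuousLinearMap.id_apply] at h1
  rw [← neg_sub, ← h1, neg_neg]

lemma B_pos {K : Set X} (hK : IsCC K) (hU : IsC0Semigroup U)
    (hV : IsC0Semigroup V) (hA : IsGeneratorOf A U) (hG : IsGeneratorOf G V)
    (hGext : ∀ u : A.domain, ∃ h : (u : X) ∈ G.domain, G ⟨(u : X), h⟩ = A u + B u)
    (hUdom : ∀ (s : ℝ), 0 ≤ s → ∀ u : A.domain, U s (u : X) ∈ A.domain) (u : A.domain)
    (hpos : ∀ t : ℝ, 0 < t → (∫ s in (0:ℝ)..t,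
      U (t - s) (B ⟨U (max s 0) (u : X), hUdom (max s 0) (le_max_right _ _) u⟩)) ∈ K) :
    B u ∈ K := by
  have hc := BU_cont hU hV hA hG hGext hUdom u
  set b : ℝ → X := fun s => B ⟨U (max s 0) (u : X), hUdom (max s 0) (le_max_right _ _) u⟩ with hb
  have hb0 : b 0 = B u := by
    simp only [hb]; congr 1; exact Subtype.ext (by simp [hU.map_zero])
  have hlim : Tendsto (fun t : ℝ => t⁻¹ • ∫ s in (0:ℝ)..t, U (t - s) (b s)) (𝓝[>] 0) (𝓝 (B u)) := by
    rw [Metric.tendsto_nhds]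
    intro ε hε
    have hj : ContinuousOn (fun p : ℝ × ℝ => U p.1 (b p.2)) (Ici 0 ×ˢ univ) :=
      strong_comp U hU.strongCont _ _ (by fun_prop) (by fun_prop) (fun x hx => hx.1)
    have h1 := (hj (0, 0) ⟨by simp, trivial⟩).tendsto
    have h2 : U ((0, 0) : ℝ × ℝ).1 (b ((0, 0) : ℝ × ℝ).2) = B u := by simp [hU.map_zero, hb0]
    rw [h2] at h1
    have h3 := Metric.tendsto_nhds.1 h1 (ε / 2) (by positivity)
    obtain ⟨δ, hδ, h3⟩ := Metric.mem_nhdsWithin_iff.1 h3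
    filter_upwards [self_mem_nhdsWithin, nhdsWithin_le_nhds (gt_mem_nhds hδ)] with t ht htδ
    have ht : 0 < t := ht
    have hi : IntervalIntegrable (fun s => U (t - s) (b s)) volume 0 t :=
      (strong_comp U hU.strongCont _ _ (by fun_prop) hc.continuousOn
        (fun x hx => by linarith [hx.2])).intervalIntegrable_of_Icc ht.le
    have e : (t⁻¹ • ∫ s in (0:ℝ)..t, U (t - s) (b s)) - B u =
        t⁻¹ • ∫ s in (0:ℝ)..t, (U (t - s) (b s) - B u) := by
      rw [intervalIntegral.integral_sub hi (by simp)]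
      simp [smul_sub, smul_smul, ht.ne']
    rw [dist_eq_norm, e, norm_smul]
    have h4 : ‖∫ s in (0:ℝ)..t, (U (t - s) (b s) - B u)‖ ≤ ε / 2 * |t - 0| := by
      apply intervalIntegral.norm_integral_le_of_norm_le_const
      intro s hs
      rw [uIoc_of_le ht.le] at hs
      have hm : (t - s, s) ∈ Metric.ball ((0, 0) : ℝ × ℝ) δ := by
        rw [Metric.mem_ball, Prod.dist_eq]
        simp only [Real.dist_eq, sub_zero, max_lt_iff]
        rw [abs_of_nonneg (by linarith [hs.2]), abs_of_nonneg hs.1.le]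
        constructor <;> linarith [hs.1, hs.2]
      have : dist (U (t - s) (b s)) (B u) < ε / 2 := h3 ⟨hm, ⟨by simpa using hs.2, trivial⟩⟩
      rw [dist_eq_norm] at this
      exact this.le
    rw [sub_zero, abs_of_pos ht] at h4
    calc ‖t⁻¹‖ * _ ≤ ‖t⁻¹‖ * (ε / 2 * t) := by gcongr
      _ = ε / 2 := by rw [Real.norm_of_nonneg (by positivity)]; field_simp
      _ < ε := by linarith
  refine hK.closed.mem_of_tendsto hlim ?_
  filter_upwards [self_mem_nhdsWithin] with t ht
  exact hK.smul _ (inv_nonneg.2 (le_of_lt ht)) _ (hpos t ht)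

/-- The main domination inequality. -/
lemma domination {K : Set X} (hK : IsCC K) (hU : IsC0Semigroup U)
    (hV : IsC0Semigroup V) (hA : IsGeneratorOf A U) (hG : IsGeneratorOf G V)
    (hGext : ∀ u : A.domain, ∃ h : (u : X) ∈ G.domain, G ⟨(u : X), h⟩ = A u + B u)
    (hUdom : ∀ (s : ℝ), 0 ≤ s → ∀ u : A.domain, U s (u : X) ∈ A.domain)
    (hUK : ∀ t, 0 ≤ t → ∀ u ∈ K, U t u ∈ K) (hVK : ∀ t, 0 ≤ t → ∀ u ∈ K, V t u ∈ K)
    (Vn : ℕ → ℝ → X →L[ℝ] X)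
    (hVnK : ∀ (n : ℕ) (t : ℝ), 0 ≤ t → ∀ u ∈ K, Vn n t u ∈ K)
    (hVncont : ∀ (n : ℕ) (u : X), ContinuousOn (fun t => Vn n t u) (Ici (0 : ℝ)))
    (hV0 : Vn 0 = U)
    (hVrec : ∀ (n : ℕ) (t : ℝ), 0 ≤ t → ∀ u : A.domain,
      Vn (n + 1) t (u : X) =
        ∫ s in (0:ℝ)..t,
          Vn n (t - s) (B ⟨U (max s 0) (u : X), hUdom (max s 0) (le_max_right _ _) u⟩))
    (N : ℕ) : ∀ t r : ℝ, 0 ≤ t → 0 ≤ r → ∀ u ∈ K,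
      (∑ n ∈ Finset.range (N + 1), Vn n r (V t u)) -
        (∑ n ∈ Finset.range (N + 1), Vn n (t + r) u) ∈ K := by
  have hBK : ∀ u : A.domain, (u : X) ∈ K → B u ∈ K := by
    intro u hu
    apply B_pos hK hU hV hA hG hGext hUdom u
    intro t ht
    have h := hVnK 1 t ht.le u hu
    rw [hVrec 0 t ht.le u, hV0] at h
    exact h
  -- reduction to the domain
  have hred : ∀ S : X →L[ℝ] X, (∀ u : A.domain, (u : X) ∈ K → S u ∈ K) → ∀ u ∈ K, S u ∈ K := by
    intro S hS u hu
    have h1 := int_deriv hU.strongCont u 0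
    simp only [max_self, hU.map_zero, zero_add, ContinuousLinearMap.id_apply,
      intervalIntegral.integral_same, sub_zero] at h1
    refine hK.closed.mem_of_tendsto ((S.continuous.tendsto _).comp h1) ?_
    filter_upwards [self_mem_nhdsWithin] with h hh
    have hh : 0 < h := hh
    obtain ⟨hm, -⟩ := gen_int_mem hU hA u hh.le
    have := int_max (T := U) u hh.le
    simp only [Function.comp]
    rw [← this, map_smul]
    refine hK.smul _ (inv_nonneg.2 hh.le) _ (hS ⟨_, hm⟩ ?_)
    exact hK.interval_mem hh.le _ (fun x hx => hUK x hx.1.le u hu)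
  have hVU : ∀ t, 0 ≤ t → ∀ u ∈ K, V t u - U t u ∈ K := by
    intro t ht
    apply hred (V t - U t)
    intro u hu
    rw [sub_apply, duhamel hU hV hA hG hGext hUdom u ht]
    apply hK.interval_mem ht
    intro s hs
    exact hVK _ (by linarith [hs.2]) _ (hBK _ (hUK _ (le_max_right _ _) _ hu))
  induction N with
  | zero =>
    intro t r ht hr u hu
    simp only [zero_add, Finset.range_one, Finset.sum_singleton, hV0]
    rw [add_comm t r, hU.map_add r t hr ht]
    have := hUK r hr _ (hVU t ht u hu)
    rwa [map_sub] at this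
  | succ N ih =>
    intro t r ht hr
    have := hred ((∑ n ∈ Finset.range (N + 1 + 1), (Vn n r).comp (V t)) -
        (∑ n ∈ Finset.range (N + 1 + 1), Vn n (t + r))) ?_
    · intro u hu
      simpa using this u hu
    intro u hu
    set b : ℝ → X := fun s => B ⟨U (max s 0) (u : X), hUdom (max s 0) (le_max_right _ _) u⟩ with hb
    have hc : Continuous b := BU_cont hU hV hA hG hGext hUdom u
    have hbK : ∀ s, b s ∈ K := fun s => hBK _ (hUK _ (le_max_right _ _) _ hu)
    have hint : ∀ n, ∀ a c d : ℝ, a ≤ c → c ≤ d →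
        IntervalIntegrable (fun s => Vn n (d - s) (b s)) volume a c := fun n a c d hac hcd =>
      (strong_comp (Vn n) (hVncont n) _ _ (by fun_prop) hc.continuousOn
        (fun x hx => by linarith [hx.2])).intervalIntegrable_of_Icc hac
    -- recursion for the partial sums
    have e1 : ∑ n ∈ Finset.range (N + 1 + 1), Vn n (t + r) u =
        U (t + r) u + ∑ n ∈ Finset.range (N + 1), ∫ s in (0:ℝ)..(t + r), Vn n (t + r - s) (b s) := by
      rw [Finset.sum_range_succ', hV0, add_comm]
      congr 1
      exact Finset.sum_congr rfl fun n _ => hVrec n (t + r) (by linarith) u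
    let y : A.domain := ⟨U t u, hUdom t ht u⟩
    have e2 : ∑ n ∈ Finset.range (N + 1 + 1), Vn n r (U t u) =
        U (t + r) u + ∑ n ∈ Finset.range (N + 1), ∫ s in t..(t + r), Vn n (t + r - s) (b s) := by
      rw [Finset.sum_range_succ', hV0, add_comm, add_comm t r, hU.map_add r t hr ht]
      congr 1
      refine Finset.sum_congr rfl fun n _ => ?_
      rw [hVrec n r hr y]
      have := intervalIntegral.integral_comp_add_right (a := 0) (b := r)
        (fun s => Vn n (r + t - s) (b s)) t
      rw [zero_add] at this
      rw [← this]
      apply intervalIntegral.integral_congr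
      intro s hs
      rw [uIcc_of_le hr] at hs
      have e3 : r + t - (s + t) = r - s := by ring
      simp only [e3]
      congr 1
      simp only [hb]
      congr 1
      refine Subtype.ext ?_
      simp only [y]
      rw [max_eq_left hs.1, max_eq_left (by linarith [hs.1]), hU.map_add s t hs.1 ht]; rfl
    have e3 : (∑ n ∈ Finset.range (N + 1), ∫ s in (0:ℝ)..(t + r), Vn n (t + r - s) (b s)) =
        (∑ n ∈ Finset.range (N + 1), ∫ s in (0:ℝ)..t, Vn n (t + r - s) (b s)) +
        ∑ n ∈ Finset.range (N + 1), ∫ s in t..(t + r), Vn n (t + r - s) (b s) := by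
      rw [← Finset.sum_add_distrib]
      refine Finset.sum_congr rfl fun n _ => ?_
      rw [intervalIntegral.integral_add_adjacent_intervals (hint n _ _ _ ht (by linarith))
        (hint n _ _ _ (by linarith) le_rfl)]
    have hVint : IntervalIntegrable (fun s => V (t - s) (b s)) volume 0 t :=
      (strong_comp V hV.strongCont _ _ (by fun_prop) hc.continuousOn
        (fun x hx => by linarith [hx.2])).intervalIntegrable_of_Icc ht
    have hVint' : ∀ n, IntervalIntegrable (fun s => Vn n r (V (t - s) (b s))) volume 0 t :=
      fun n => ((Vn n r).continuous.comp_continuousOn (strong_comp V hV.strongCont _ _ (by fun_prop)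
        hc.continuousOn (fun x hx => by linarith [hx.2]))).intervalIntegrable_of_Icc ht
    have hd : V t u - U t u = ∫ s in (0:ℝ)..t, V (t - s) (b s) :=
      duhamel hU hV hA hG hGext hUdom u ht
    have e4 : ∑ n ∈ Finset.range (N + 1), Vn n r (V t u - U t u) =
        ∑ n ∈ Finset.range (N + 1), ∫ s in (0:ℝ)..t, Vn n r (V (t - s) (b s)) := by
      refine Finset.sum_congr rfl fun n _ => ?_
      rw [hd, (Vn n r).intervalIntegral_comp_comm hVint]
    have k1 : (∑ n ∈ Finset.range (N + 1), Vn n r (V t u - U t u)) -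
        (∑ n ∈ Finset.range (N + 1), ∫ s in (0:ℝ)..t, Vn n (t + r - s) (b s)) ∈ K := by
      rw [e4, ← intervalIntegral.integral_finsetSum (fun n _ => hVint' n),
        ← intervalIntegral.integral_finsetSum (fun n _ => hint n _ _ _ ht (by linarith)),
        ← intervalIntegral.integral_sub]
      · apply hK.interval_mem ht
        intro s hs
        have := ih (t - s) r (by linarith [hs.2]) hr (b s) (hbK s)
        rwa [show t - s + r = t + r - s by ring] at this
      · have := IntervalIntegrable.sum (Finset.range (N + 1)) (fun n _ => hVint' n)
        simpa only [Finset.sum_fn] using this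
      · have := IntervalIntegrable.sum (Finset.range (N + 1))
          (fun n _ => hint n 0 t (t + r) ht (by linarith))
        simpa only [Finset.sum_fn] using this
    have k2 : Vn (N + 1) r (V t u - U t u) ∈ K := hVnK _ r hr _ (hVU t ht u hu)
    have k3 := hK.add _ k1 _ k2
    have : ((∑ n ∈ Finset.range (N + 1 + 1), (Vn n r).comp (V t)) -
        (∑ n ∈ Finset.range (N + 1 + 1), Vn n (t + r))) u =
        (∑ n ∈ Finset.range (N + 1 + 1), Vn n r (V t u)) -
        (∑ n ∈ Finset.range (N + 1 + 1), Vn n (t + r) u) := by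
      simp
    rw [this, e1, e3]
    have e5 : ∑ n ∈ Finset.range (N + 1 + 1), Vn n r (V t u) =
        (∑ n ∈ Finset.range (N + 1 + 1), Vn n r (V t u - U t u)) +
        ∑ n ∈ Finset.range (N + 1 + 1), Vn n r (U t u) := by
      rw [← Finset.sum_add_distrib]; simp
    rw [e5, e2, Finset.sum_range_succ]
    convert k3 using 1
    abel
end ctx
section res
variable {V : ℝ → X →L[ℝ] X} {G : X →ₗ.[ℝ] X}

lemma res_cont (hV : IsC0Semigroup V) (u : X) :
    ContinuousOn (fun s : ℝ => Real.exp (-s) • V s u) (Ici 0) :=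
  ContinuousOn.smul (by fun_prop) (hV.strongCont u)

lemma res_int (hV : IsC0Semigroup V) {C : ℝ} (hC : ∀ t, 0 ≤ t → ∀ u, ‖V t u‖ ≤ C * ‖u‖) (u : X) :
    IntegrableOn (fun s : ℝ => Real.exp (-s) • V s u) (Ioi 0) := by
  have h1 : IntegrableOn (fun s : ℝ => Real.exp (-s) * (C * ‖u‖)) (Ioi 0) :=
    (integrableOn_exp_neg_Ioi 0).mul_const _
  refine Integrable.mono' h1
    (((res_cont hV u).mono Ioi_subset_Ici_self).aestronglyMeasurable measurableSet_Ioi) ?_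
  refine (ae_restrict_iff' measurableSet_Ioi).2 (Eventually.of_forall fun s hs => ?_)
  rw [norm_smul, Real.norm_of_nonneg (Real.exp_pos _).le]
  exact mul_le_mul_of_nonneg_left (hC s (le_of_lt hs) u) (Real.exp_pos _).le

lemma res_gen (hV : IsC0Semigroup V) {C : ℝ} (hC : ∀ t, 0 ≤ t → ∀ u, ‖V t u‖ ≤ C * ‖u‖)
    (hG : IsGeneratorOf G V) (v : G.domain) :
    ∫ s in Ioi (0:ℝ), Real.exp (-s) • V s ((v : X) - G v) = v := by
  have h1 := intervalIntegral_tendsto_integral_Ioi (μ := volume) 0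
    (res_int hV hC ((v : X) - G v)) (tendsto_id (α := ℝ) (x := atTop))
  have h2 : ∀ t : ℝ, 0 ≤ t → ∫ s in (0:ℝ)..t, Real.exp (-s) • V s ((v : X) - G v) =
      v - Real.exp (-t) • V t v := by
    intro t ht
    have := intervalIntegral.integral_eq_sub_of_hasDeriv_right_of_le
      (f := fun s : ℝ => -(Real.exp (-s) • V s (v : X)))
      (f' := fun s => Real.exp (-s) • V s ((v : X) - G v)) ht
      ((res_cont hV v).mono Icc_subset_Ici_self).neg
      (fun s hs => by
        have d1 : HasDerivWithinAt (fun s : ℝ => Real.exp (-s)) (-Real.exp (-s)) (Ioi s) s := by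
          have := ((hasDerivAt_neg s).exp).hasDerivWithinAt (s := Ioi s)
          simpa using this
        have d2 := hasRight (f := fun s => V s (v : X)) (gen_right hV hG v hs.1.le)
        have d3 := (d1.smul d2).neg
        refine d3.congr_deriv ?_
        simp only [map_sub, smul_sub, neg_smul, neg_add_rev, neg_neg]
        abel)
      (((res_cont hV _).mono Icc_subset_Ici_self).intervalIntegrable_of_Icc ht)
    rw [this]
    simp [hV.map_zero]
    abel
  refine tendsto_nhds_unique h1 ?_
  have h3 : Tendsto (fun t : ℝ => Real.exp (-t) • V t (v : X)) atTop (𝓝 0) := by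
    have h4 : Tendsto (fun t : ℝ => Real.exp (-t) * (C * ‖(v : X)‖)) atTop (𝓝 0) := by
      have := Real.tendsto_exp_neg_atTop_nhds_zero.mul_const (C * ‖(v : X)‖)
      simpa using this
    refine squeeze_zero_norm' ?_ h4
    filter_upwards [eventually_ge_atTop 0] with t ht
    rw [norm_smul, Real.norm_of_nonneg (Real.exp_pos _).le]
    exact mul_le_mul_of_nonneg_left (hC t ht v) (Real.exp_pos _).le
  have h5 := (tendsto_const_nhds (x := (v : X))).sub h3
  rw [sub_zero] at h5
  refine h5.congr' ?_
  filter_upwards [eventually_ge_atTop 0] with t ht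
  exact (h2 t ht).symm

lemma res_shift (hV : IsC0Semigroup V) {C : ℝ} (hC : ∀ t, 0 ≤ t → ∀ u, ‖V t u‖ ≤ C * ‖u‖)
    (u : X) {t : ℝ} (ht : 0 ≤ t) :
    V t (∫ s in Ioi (0:ℝ), Real.exp (-s) • V s u) =
      Real.exp t • ((∫ s in Ioi (0:ℝ), Real.exp (-s) • V s u) -
        ∫ s in (0:ℝ)..t, Real.exp (-s) • V s u) := by
  have h1 := intervalIntegral_tendsto_integral_Ioi (μ := volume) 0
    (res_int hV hC u) (tendsto_id (α := ℝ) (x := atTop))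
  have h2 := intervalIntegral_tendsto_integral_Ioi (μ := volume) 0
    (res_int hV hC u) (tendsto_atTop_add_const_right atTop t (tendsto_id (α := ℝ) (x := atTop)))
  have h3 := ((V t).continuous.tendsto _).comp h1
  have h4 := (h2.sub_const (∫ s in (0:ℝ)..t, Real.exp (-s) • V s u)).const_smul (Real.exp t)
  refine tendsto_nhds_unique h3 (h4.congr' ?_)
  filter_upwards [eventually_ge_atTop 0] with r hr
  have hi : ∀ a b : ℝ, 0 ≤ a → a ≤ b →
      IntervalIntegrable (fun s : ℝ => Real.exp (-s) • V s u) volume a b := fun a b ha hab =>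
    ((res_cont hV u).mono (fun x hx => ha.trans hx.1)).intervalIntegrable_of_Icc hab
  simp only [Function.comp, id]
  rw [← (V t).intervalIntegral_comp_comm (hi 0 r le_rfl hr),
    ← intervalIntegral.integral_add_adjacent_intervals (hi 0 t le_rfl ht)
      (hi t (r + t) ht (by linarith)), add_sub_cancel_left]
  have := intervalIntegral.integral_comp_add_right (a := 0) (b := r)
    (fun s : ℝ => Real.exp (-s) • V s u) t
  rw [zero_add] at this
  rw [← this, ← intervalIntegral.integral_smul]
  apply intervalIntegral.integral_congr
  intro s hs
  rw [uIcc_of_le hr] at hs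
  simp only
  rw [smul_smul, ← Real.exp_add, map_smul, add_comm s t, hV.map_add t s ht hs.1]
  simp
end res
lemma fekete (f : ℝ → ℝ) (C : ℝ) (h0 : ∀ t, 0 < t → 0 ≤ f t)
    (hmono : ∀ s t, 0 < s → s ≤ t → f s ≤ f t)
    (hsub : ∀ s t, 0 < s → 0 < t → f (t + s) ≤ f t + Real.exp t * f s)
    (hC : ∀ t, 0 < t → f t ≤ C * t * Real.exp t) :
    ∃ L, Tendsto (fun t => t⁻¹ * f t) (𝓝[>] 0) (𝓝 L) ∧ 0 ≤ L ∧ L ≤ C := by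
  have hmul : ∀ n : ℕ, ∀ s, 0 < s → f ((n + 1 : ℕ) * s) ≤ (n + 1 : ℕ) * Real.exp ((n + 1 : ℕ) * s) * f s := by
    intro n s hs
    induction n with
    | zero =>
      have : 1 ≤ Real.exp s := Real.one_le_exp hs.le
      simpa using le_mul_of_one_le_left (h0 s hs) this
    | succ n ih =>
      have e : ((n + 1 + 1 : ℕ) : ℝ) * s = ((n + 1 : ℕ) : ℝ) * s + s := by push_cast; ring
      have h1 := hsub s (((n + 1 : ℕ) : ℝ) * s) hs (by positivity)
      rw [e]
      have h2 : Real.exp (((n + 1 : ℕ) : ℝ) * s) ≤ Real.exp (((n + 1 : ℕ) : ℝ) * s + s) :=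
        Real.exp_le_exp.2 (by linarith)
      have h3 : 0 ≤ f s := h0 s hs
      calc _ ≤ _ := h1
        _ ≤ (n + 1 : ℕ) * Real.exp ((n + 1 : ℕ) * s) * f s + Real.exp ((n + 1 : ℕ) * s) * f s := by
          linarith
        _ = (n + 1 + 1 : ℕ) * f s * Real.exp ((n + 1 : ℕ) * s) := by push_cast; ring
        _ ≤ (n + 1 + 1 : ℕ) * f s * Real.exp (((n + 1 : ℕ) : ℝ) * s + s) := by gcongr
        _ = _ := by ring
  have hkey : ∀ t s, 0 < t → 0 < s → f t ≤ (t + s) * Real.exp (t + s) * (s⁻¹ * f s) := by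
    intro t s ht hs
    obtain ⟨n, hn⟩ : ∃ n : ℕ, ⌈t / s⌉₊ = n + 1 :=
      Nat.exists_eq_succ_of_ne_zero (Nat.ceil_pos.2 (by positivity)).ne'
    have h1 : t ≤ (n + 1 : ℕ) * s := by
      rw [← hn]; exact (div_le_iff₀ hs).1 (Nat.le_ceil _)
    have h2 : (n + 1 : ℕ) * s ≤ t + s := by
      rw [← hn]
      have := (Nat.ceil_lt_add_one (a := t / s) (by positivity)).le
      calc _ ≤ (t / s + 1) * s := by gcongr
        _ = t + s := by field_simp
    have h3 := h0 s hs
    calc f t ≤ f ((n + 1 : ℕ) * s) := hmono _ _ ht h1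
      _ ≤ _ := hmul n s hs
      _ = ((n + 1 : ℕ) * s) * Real.exp ((n + 1 : ℕ) * s) * (s⁻¹ * f s) := by field_simp
      _ ≤ _ := by gcongr
  let q : ℝ → ℝ := fun t => Real.exp (-t) * (t⁻¹ * f t)
  have hqC : ∀ t, 0 < t → q t ≤ C := by
    intro t ht
    calc q t ≤ Real.exp (-t) * (t⁻¹ * (C * t * Real.exp t)) := by
          simp only [q]; gcongr; exact hC t ht
      _ = C * (Real.exp (-t) * Real.exp t) := by field_simp
      _ = C := by rw [← Real.exp_add]; simp
  let S : Set ℝ := q '' Ioi 0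
  have hS : BddAbove S := ⟨C, by rintro _ ⟨t, ht, rfl⟩; exact hqC t ht⟩
  have hne : S.Nonempty := ⟨q 1, 1, by simp, rfl⟩
  have hlim : Tendsto q (𝓝[>] 0) (𝓝 (sSup S)) := by
    rw [tendsto_order]
    constructor
    · intro a ha
      obtain ⟨_, ⟨t, ht, rfl⟩, hat⟩ := exists_lt_of_lt_csSup hne ha
      have ht : 0 < t := ht
      have hc : Tendsto (fun s => Real.exp (-s) * (f t / ((t + s) * Real.exp (t + s)))) (𝓝[>] 0)
          (𝓝 (Real.exp (-0) * (f t / ((t + 0) * Real.exp (t + 0))))) := by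
        refine Tendsto.mono_left ?_ nhdsWithin_le_nhds
        have : ContinuousAt (fun s => Real.exp (-s) * (f t / ((t + s) * Real.exp (t + s)))) 0 := by
          apply ContinuousAt.mul (by fun_prop)
          apply ContinuousAt.div (by fun_prop) (by fun_prop)
          simp [ht.ne']
        exact this
      have e : Real.exp (-0) * (f t / ((t + 0) * Real.exp (t + 0))) = q t := by
        simp [q, Real.exp_neg]; field_simp
      rw [e] at hc
      filter_upwards [hc.eventually (lt_mem_nhds hat), self_mem_nhdsWithin] with s hs hs0
      have hs0 : 0 < s := hs0
      refine hs.trans_le ?_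
      simp only [q]
      gcongr
      rw [div_le_iff₀ (by positivity), mul_comm]
      exact hkey t s ht hs0
    · intro a ha
      filter_upwards [self_mem_nhdsWithin] with t ht
      exact (le_csSup hS ⟨t, ht, rfl⟩).trans_lt ha
  have hfin : Tendsto (fun t => t⁻¹ * f t) (𝓝[>] 0) (𝓝 (sSup S)) := by
    have h1 : Tendsto (fun t => Real.exp t) (𝓝[>] 0) (𝓝 1) := by
      have := (Real.continuous_exp.tendsto 0).mono_left (nhdsWithin_le_nhds (s := Ioi 0))
      simpa using this
    have h2 := h1.mul hlim
    rw [one_mul] at h2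
    refine h2.congr fun t => ?_
    simp only [q]
    rw [← mul_assoc, ← Real.exp_add]; simp
  refine ⟨sSup S, hfin, ?_, ?_⟩
  · refine ge_of_tendsto hfin ?_
    filter_upwards [self_mem_nhdsWithin] with t ht
    have ht : 0 < t := ht
    have := h0 t ht
    positivity
  · exact csSup_le hne (by rintro _ ⟨t, ht, rfl⟩; exact hqC t ht)
/-- The functional `a` as a linear map. -/
def aLin (Ψ : X →L[ℝ] ℝ) (A : X →ₗ.[ℝ] X) (B : A.domain →ₗ[ℝ] X) : A.domain →ₗ[ℝ] ℝ :=
  -(Ψ.toLinearMap.comp (A.toFun + B))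

lemma aLin_apply (Ψ : X →L[ℝ] ℝ) (A : X →ₗ.[ℝ] X) (B : A.domain →ₗ[ℝ] X) (w : A.domain) :
    aFun Ψ A B w = aLin Ψ A B w := rfl

/-- For every `v ∈ D(G)` the limit `â(v) = lim_{t→0⁺} (1/t) Σₙ a(∫₀ᵗ Vₙ(s)v ds)` exists,
with `|â(v)| ≤ 4M(‖v‖ + ‖Gv‖)`; furthermore `â(v) ≤ a₀(v) ≤ ‖Gv‖` for `v ∈ D(G)₊`
(`a₀(v) = -⟨Ψ, Gv⟩`). -/
theorem ahat_exists
    (hconeadd : ∀ u v : X, 0 ≤ u → 0 ≤ v → 0 ≤ u + v)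
    (hconesmul : ∀ (c : ℝ) (u : X), 0 ≤ c → 0 ≤ u → 0 ≤ c • u)
    (hgen : ∀ u : X, ∃ v w : X, 0 ≤ v ∧ 0 ≤ w ∧ u = v - w)
    (haddnorm : ∀ u v : X, 0 ≤ u → 0 ≤ v → ‖u + v‖ = ‖u‖ + ‖v‖)
    (Ψ : X →L[ℝ] ℝ) (hΨ : ∀ u : X, 0 ≤ u → Ψ u = ‖u‖)
    (U : ℝ → X →L[ℝ] X) (hU : IsSubstochastic U)
    (A : X →ₗ.[ℝ] X) (hA : IsGeneratorOf A U)
    (B : A.domain →ₗ[ℝ] X)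
    (hBpos : ∀ u : A.domain, 0 ≤ (u : X) → 0 ≤ B u)
    (hdiss : ∀ u : A.domain, 0 ≤ (u : X) → Ψ (A u + B u) ≤ 0)
    -- the minimal substochastic semigroup V generated by an extension G of A + B
    (G : X →ₗ.[ℝ] X) (V : ℝ → X →L[ℝ] X)
    (hV : IsSubstochastic V) (hGV : IsGeneratorOf G V)
    (hGext : ∀ u : A.domain, ∃ h : (u : X) ∈ G.domain, G ⟨(u : X), h⟩ = A u + B u)
    -- U leaves D(A) invariant
    (hUdom : ∀ (s : ℝ), 0 ≤ s → ∀ u : A.domain, U s (u : X) ∈ A.domain)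
    -- the Dyson-Phillips iterates: V₀ = U, V_{n+1}(t)u = ∫₀ᵗ Vₙ(t-s) B U(s)u ds on D(A),
    -- each extended to a bounded positive operator on X
    (Vn : ℕ → ℝ → X →L[ℝ] X)
    (hVnpos : ∀ (n : ℕ) (t : ℝ), 0 ≤ t → ∀ u : X, 0 ≤ u → 0 ≤ Vn n t u)
    (hVncont : ∀ (n : ℕ) (u : X), ContinuousOn (fun t => Vn n t u) (Ici (0 : ℝ)))
    (hV0 : Vn 0 = U)
    (hVrec : ∀ (n : ℕ) (t : ℝ), 0 ≤ t → ∀ u : A.domain,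
      Vn (n + 1) t (u : X) =
        ∫ s in (0:ℝ)..t,
          Vn n (t - s) (B ⟨U (max s 0) (u : X), hUdom (max s 0) (le_max_right _ _) u⟩))
    -- the non-flatness constant of the cone
    (M : ℝ) (hM : 0 < M)
    (hMdec : ∀ u : X, ∃ v w : X, 0 ≤ v ∧ 0 ≤ w ∧ u = v - w ∧ ‖v‖ ≤ M * ‖u‖ ∧ ‖w‖ ≤ M * ‖u‖)
    -- ∫₀ᵗ Vₙ(s)u ds belongs to D(A)
    (memInt : ∀ (n : ℕ) (t : ℝ) (u : X), (∫ s in (0:ℝ)..t, Vn n s u) ∈ A.domain) :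
    ∀ v : G.domain,
      (∀ t : ℝ, 0 < t →
        Summable (fun n : ℕ =>
          aFun Ψ A B ⟨∫ s in (0:ℝ)..t, Vn n s (v : X), memInt n t (v : X)⟩)) ∧
      ∃ L : ℝ,
        Tendsto (fun t : ℝ =>
            t⁻¹ * ∑' n : ℕ,
              aFun Ψ A B ⟨∫ s in (0:ℝ)..t, Vn n s (v : X), memInt n t (v : X)⟩)
          (𝓝[>] 0) (𝓝 L) ∧
        |L| ≤ 4 * M * (‖(v : X)‖ + ‖G v‖) ∧
        (0 ≤ (v : X) → L ≤ -Ψ (G v) ∧ -Ψ (G v) ≤ ‖G v‖) := by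
  have hUs := hU.1
  have hVs := hV.1
  set K : Set X := closure {u : X | 0 ≤ u} with hKdef
  have hsub : ∀ u : X, 0 ≤ u → u ∈ K := fun u hu => subset_closure hu
  have hK : IsCC K :=
    { closed := isClosed_closure
      zero := hsub 0 le_rfl
      add := fun u hu v hv => map_mem_closure₂ continuous_add hu hv (fun a ha b hb => hconeadd a b ha hb)
      smul := fun c hc u hu => map_mem_closure (continuous_const_smul c) hu
        (fun a ha => hconesmul c a hc ha) }
  have hΨK : ∀ u ∈ K, Ψ u = ‖u‖ := fun u hu =>
    closure_minimal (fun u hu => hΨ u hu) (isClosed_eq Ψ.continuous continuous_norm) hu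
  have hmapK : ∀ S : X →L[ℝ] X, (∀ u, 0 ≤ u → 0 ≤ S u) → ∀ u ∈ K, S u ∈ K := fun S hS u hu =>
    map_mem_closure S.continuous hu (fun a ha => hS a ha)
  have hUK : ∀ t, 0 ≤ t → ∀ u ∈ K, U t u ∈ K := fun t ht => hmapK _ fun u hu => (hU.2 t ht u hu).1
  have hVK : ∀ t, 0 ≤ t → ∀ u ∈ K, V t u ∈ K := fun t ht => hmapK _ fun u hu => (hV.2 t ht u hu).1
  have hVnK : ∀ n t, 0 ≤ t → ∀ u ∈ K, Vn n t u ∈ K := fun n t ht => hmapK _ (hVnpos n t ht)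
  have hVcon : ∀ t, 0 ≤ t → ∀ u ∈ K, ‖V t u‖ ≤ ‖u‖ := fun t ht u hu =>
    closure_minimal (s := {u : X | 0 ≤ u}) (t := {u : X | ‖V t u‖ ≤ ‖u‖})
      (fun u hu => (hV.2 t ht u hu).2)
      (isClosed_le ((V t).continuous.norm) continuous_norm) hu
  have hC : ∀ t, 0 ≤ t → ∀ u, ‖V t u‖ ≤ (2 * M) * ‖u‖ := by
    intro t ht u
    obtain ⟨x, y, hx, hy, rfl, h1, h2⟩ := hMdec u
    rw [map_sub]
    have h3 := (hV.2 t ht x hx).2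
    have h4 := (hV.2 t ht y hy).2
    have := norm_sub_le (V t x) (V t y)
    linarith
  have hΨle : ∀ x, |Ψ x| ≤ ‖x‖ := by
    intro x
    obtain ⟨y, z, hy, hz, rfl⟩ := hgen x
    rw [map_sub, hΨ y hy, hΨ z hz]
    exact abs_norm_sub_norm_le y z
  have hdom := domination hK hUs hVs hA hGV hGext hUdom hUK hVK Vn hVnK hVncont hV0 hVrec
  have hdom' : ∀ N : ℕ, ∀ t, 0 ≤ t → ∀ u ∈ K, V t u - ∑ n ∈ Finset.range N, Vn n t u ∈ K := by
    intro N t ht u hu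
    have h1 := hdom N t 0 ht le_rfl u hu
    have hz : ∀ n, ∀ x : X, Vn (n + 1) 0 x = 0 := by
      intro n x
      have hd : ∀ y : A.domain, Vn (n + 1) 0 (y : X) = 0 := fun y => by
        rw [hVrec n 0 le_rfl y]; simp
      have h1 := int_deriv hUs.strongCont x 0
      simp only [max_self, hUs.map_zero, zero_add, ContinuousLinearMap.id_apply,
        intervalIntegral.integral_same, sub_zero] at h1
      refine tendsto_nhds_unique (((Vn (n + 1) 0).continuous.tendsto _).comp h1) ?_
      refine tendsto_const_nhds.congr' ?_
      filter_upwards [self_mem_nhdsWithin] with h hh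
      obtain ⟨hm, -⟩ := gen_int_mem hUs hA x (le_of_lt hh)
      have := int_max (T := U) x (le_of_lt hh)
      simp only [Function.comp]
      rw [← this, map_smul, hd ⟨_, hm⟩, smul_zero]
    rw [Finset.sum_range_succ' (fun n => Vn n 0 (V t u))] at h1
    simp only [hz, hV0, hUs.map_zero, add_zero, Finset.sum_const_zero, zero_add,
      ContinuousLinearMap.id_apply, Finset.sum_range_succ] at h1
    have h2 := hK.add _ h1 _ (hVnK N t ht u hu)
    convert h2 using 1
    abel
  have hGneg : ∀ z : G.domain, (z : X) ∈ K → Ψ (G z) ≤ 0 := by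
    intro z hz
    refine le_of_tendsto ((Ψ.continuous.tendsto _).comp (hGV.2 z)) ?_
    filter_upwards [self_mem_nhdsWithin] with t ht
    have ht : 0 < t := ht
    simp only [Function.comp, map_smul, map_sub, smul_eq_mul]
    rw [hΨK _ (hVK t ht.le z hz), hΨK _ hz]
    exact mul_nonpos_of_nonneg_of_nonpos (inv_nonneg.2 ht.le) (by linarith [hVcon t ht.le z hz])
  have haG : ∀ w : A.domain, ∃ h : (w : X) ∈ G.domain, aLin Ψ A B w = -Ψ (G ⟨w, h⟩) := by
    intro w
    obtain ⟨h, e⟩ := hGext w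
    exact ⟨h, by rw [e]; rfl⟩
  have hapos : ∀ w : A.domain, (w : X) ∈ K → 0 ≤ aLin Ψ A B w := by
    intro w hw
    obtain ⟨h, e⟩ := haG w
    rw [e]
    linarith [hGneg ⟨w, h⟩ hw]
  simp only [aLin_apply]
  set I : ℕ → ℝ → X → A.domain := fun n t x => ⟨∫ s in (0:ℝ)..t, Vn n s x, memInt n t x⟩ with hI
  set α : ℕ → ℝ → X → ℝ := fun n t x => aLin Ψ A B (I n t x) with hα
  have hint : ∀ n, ∀ x : X, ∀ a b : ℝ, 0 ≤ a → a ≤ b →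
      IntervalIntegrable (fun s => Vn n s x) volume a b := fun n x a b ha hab =>
    ((hVncont n x).mono (fun y hy => ha.trans hy.1)).intervalIntegrable_of_Icc hab
  have hα0 : ∀ n t x, 0 ≤ t → x ∈ K → 0 ≤ α n t x := fun n t x ht hx =>
    hapos _ (hK.interval_mem ht _ fun s hs => hVnK n s hs.1.le x hx)
  have hαsub : ∀ n t x y, 0 ≤ t → α n t (x - y) = α n t x - α n t y := by
    intro n t x y ht
    simp only [hα]
    rw [← map_sub]
    congr 1
    refine Subtype.ext ?_
    simp only [hI, AddSubgroupClass.coe_sub, map_sub]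
    exact intervalIntegral.integral_sub (hint n x 0 t le_rfl ht) (hint n y 0 t le_rfl ht)
  have hαmono : ∀ n s t x, 0 ≤ s → s ≤ t → x ∈ K → α n s x ≤ α n t x := by
    intro n s t x hs hst hx
    rw [← sub_nonneg]
    simp only [hα]
    rw [← map_sub]
    apply hapos
    simp only [hI, AddSubgroupClass.coe_sub]
    rw [← intervalIntegral.integral_add_adjacent_intervals (hint n x 0 s le_rfl hs)
      (hint n x s t hs hst), add_sub_cancel_left]
    exact hK.interval_mem hst _ fun r hr => hVnK n r (hs.trans hr.1.le) x hx
  have hαsum : ∀ N t x, 0 ≤ t → x ∈ K → ∑ n ∈ Finset.range N, α n t x ≤ Ψ (x - V t x) := by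
    intro N t x ht hx
    obtain ⟨hm, em⟩ := gen_int_mem hVs hGV x ht
    obtain ⟨hw, ew⟩ := haG (∑ n ∈ Finset.range N, I n t x)
    have hVint : IntervalIntegrable (fun s => V s x) volume 0 t :=
      ((hVs.strongCont x).mono Icc_subset_Ici_self).intervalIntegrable_of_Icc ht
    have hsumint : IntervalIntegrable (fun s => ∑ n ∈ Finset.range N, Vn n s x) volume 0 t := by
      have := IntervalIntegrable.sum (Finset.range N) (fun n _ => hint n x 0 t le_rfl ht)
      simpa only [Finset.sum_fn] using this
    have h1 := hGneg (⟨_, hm⟩ - ⟨_, hw⟩) (by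
      simp only [AddSubgroupClass.coe_sub, AddSubmonoidClass.coe_finset_sum, hI]
      rw [← intervalIntegral.integral_finsetSum (fun n _ => hint n x 0 t le_rfl ht),
        ← intervalIntegral.integral_sub hVint hsumint]
      exact hK.interval_mem ht _ fun s hs => hdom' N s hs.1.le x hx)
    rw [LinearPMap.map_sub, map_sub, em] at h1
    rw [map_sum] at ew
    simp only [hα]
    rw [ew]
    rw [map_sub] at h1 ⊢
    linarith
  have hsummK : ∀ t x, 0 ≤ t → x ∈ K → Summable (fun n => α n t x) := fun t x ht hx =>
    summable_of_sum_range_le (fun n => hα0 n t x ht hx) (fun N => hαsum N t x ht hx)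
  have htsumle : ∀ t x, 0 ≤ t → x ∈ K → ∑' n, α n t x ≤ Ψ (x - V t x) := fun t x ht hx =>
    Real.tsum_le_of_sum_range_le (fun n => hα0 n t x ht hx) (fun N => hαsum N t x ht hx)
  -- quasi-subadditivity
  have hqs : ∀ w ∈ K, (∀ t, 0 ≤ t → Real.exp t • w - V t w ∈ K) → ∀ s t, 0 < s → 0 < t →
      ∑' n, α n (t + s) w ≤ ∑' n, α n t w + Real.exp t * ∑' n, α n s w := by
    intro w hw hexp s t hs ht
    rw [← tsum_mul_left, ← (hsummK t w ht.le hw).tsum_add ((hsummK s w hs.le hw).mul_left _)]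
    have hst : 0 ≤ t + s := by linarith
    have hpart : ∀ N, ∑ n ∈ Finset.range (N + 1), α n (t + s) w ≤
        ∑ n ∈ Finset.range (N + 1), (α n t w + Real.exp t * α n s w) := by
      intro N
      rw [← sub_nonneg]
      have e : ∑ n ∈ Finset.range (N + 1), (α n t w + Real.exp t * α n s w) -
          ∑ n ∈ Finset.range (N + 1), α n (t + s) w =
          aLin Ψ A B (∑ n ∈ Finset.range (N + 1),
            (I n t w + Real.exp t • I n s w - I n (t + s) w)) := by
        rw [map_sum, ← Finset.sum_sub_distrib]
        refine Finset.sum_congr rfl fun n _ => ?_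
        simp only [hα, map_sub, map_add, map_smul, smul_eq_mul]
      rw [e]
      apply hapos
      have hsh : ∀ n, IntervalIntegrable (fun r => Vn n (t + r) w) volume 0 s := fun n =>
        ContinuousOn.intervalIntegrable_of_Icc hs.le
          ((hVncont n w).comp (by fun_prop) (fun r hr => add_nonneg ht.le hr.1))
      have hsm : ∀ n, IntervalIntegrable (fun r => Real.exp t • Vn n r w) volume 0 s := fun n =>
        (hint n w 0 s le_rfl hs.le).smul _
      have e2 : ((∑ n ∈ Finset.range (N + 1),
            (I n t w + Real.exp t • I n s w - I n (t + s) w) : A.domain) : X) =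
          ∫ r in (0:ℝ)..s, ∑ n ∈ Finset.range (N + 1),
            (Real.exp t • Vn n r w - Vn n (t + r) w) := by
        rw [intervalIntegral.integral_finsetSum (fun n _ => (hsm n).sub (hsh n))]
        simp only [AddSubmonoidClass.coe_finset_sum]
        refine Finset.sum_congr rfl fun n _ => ?_
        rw [intervalIntegral.integral_sub (hsm n) (hsh n), intervalIntegral.integral_smul]
        have := intervalIntegral.integral_comp_add_left (a := 0) (b := s)
          (fun r => Vn n r w) t
        rw [add_zero] at this
        rw [this]
        simp only [hI, AddSubgroupClass.coe_sub, Submodule.coe_add, Submodule.coe_smul]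
        rw [← intervalIntegral.integral_add_adjacent_intervals (hint n w 0 t le_rfl ht.le)
          (hint n w t (t + s) ht.le (by linarith))]
        abel
      rw [e2]
      apply hK.interval_mem hs.le
      intro r hr
      have k1 := hdom N t r ht.le hr.1.le w hw
      have k2 : ∑ n ∈ Finset.range (N + 1), Vn n r (Real.exp t • w - V t w) ∈ K :=
        hK.sum _ _ fun n _ => hVnK n r hr.1.le _ (hexp t ht.le)
      have k3 := hK.add _ k1 _ k2
      convert k3 using 1
      simp only [map_sub, map_smul, Finset.sum_sub_distrib]
      abel
    have hS := (hsummK t w ht.le hw).add ((hsummK s w hs.le hw).mul_left (Real.exp t))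
    refine Real.tsum_le_of_sum_range_le (fun n => hα0 n _ w hst hw) fun N => ?_
    have hnn : ∀ n, 0 ≤ α n t w + Real.exp t * α n s w := fun n =>
      add_nonneg (hα0 n t w ht.le hw) (mul_nonneg (Real.exp_pos _).le (hα0 n s w hs.le hw))
    calc ∑ n ∈ Finset.range N, α n (t + s) w ≤ ∑ n ∈ Finset.range (N + 1), α n (t + s) w := by
          rw [Finset.sum_range_succ]; linarith [hα0 N (t + s) w hst hw]
      _ ≤ _ := hpart N
      _ ≤ _ := hS.sum_le_tsum _ (fun n _ => hnn n)
  -- the limit for resolvent elements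
  have hres : ∀ u ∈ K, ∃ L, Tendsto (fun t => t⁻¹ * ∑' n, α n t
      (∫ s in Ioi (0:ℝ), Real.exp (-s) • V s u)) (𝓝[>] 0) (𝓝 L) ∧ 0 ≤ L ∧ L ≤ ‖u‖ := by
    intro u hu
    set w := ∫ s in Ioi (0:ℝ), Real.exp (-s) • V s u with hwdef
    have hw : w ∈ K := hK.integral_mem _ _ ((ae_restrict_iff' measurableSet_Ioi).2
      (Eventually.of_forall fun s hs => hK.smul _ (Real.exp_pos _).le _
        (hVK s (le_of_lt hs) u hu)))
    have hshift : ∀ t, 0 ≤ t → V t w = Real.exp t • (w - ∫ s in (0:ℝ)..t, Real.exp (-s) • V s u) :=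
      fun t ht => res_shift hVs hC u ht
    have hIK : ∀ t, 0 ≤ t → (∫ s in (0:ℝ)..t, Real.exp (-s) • V s u) ∈ K := fun t ht =>
      hK.interval_mem ht _ fun s hs => hK.smul _ (Real.exp_pos _).le _ (hVK s hs.1.le u hu)
    apply fekete
    · intro t ht
      exact tsum_nonneg fun n => hα0 n t w ht.le hw
    · intro s t hs hst
      exact (hsummK s w hs.le hw).tsum_le_tsum (fun n => hαmono n s t w hs.le hst hw)
        (hsummK t w (hs.le.trans hst) hw)
    · apply hqs w hw
      intro t ht
      rw [hshift t ht, ← smul_sub, sub_sub_cancel]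
      exact hK.smul _ (Real.exp_pos _).le _ (hIK t ht)
    · intro t ht
      refine (htsumle t w ht.le hw).trans ?_
      rw [hshift t ht.le, map_sub, map_smul, map_sub, smul_eq_mul, hΨK _ (hIK t ht.le), hΨK w hw]
      have h1 : ‖∫ s in (0:ℝ)..t, Real.exp (-s) • V s u‖ ≤ ‖u‖ * |t - 0| := by
        apply intervalIntegral.norm_integral_le_of_norm_le_const
        intro s hs
        rw [uIoc_of_le ht.le] at hs
        rw [norm_smul, Real.norm_of_nonneg (Real.exp_pos _).le]
        calc _ ≤ 1 * ‖u‖ := by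
              gcongr
              · exact Real.exp_le_one_iff.2 (by linarith [hs.1])
              · exact hVcon s hs.1.le u hu
          _ = ‖u‖ := one_mul _
      rw [sub_zero, abs_of_pos ht] at h1
      have h2 : 1 ≤ Real.exp t := Real.one_le_exp ht.le
      have h3 : 0 ≤ ‖w‖ := norm_nonneg _
      nlinarith [mul_le_mul_of_nonneg_left h1 (Real.exp_pos t).le,
        mul_nonneg (sub_nonneg.2 h2) h3]
  intro v
  obtain ⟨u₁, u₂, hu₁, hu₂, hu, hn₁, hn₂⟩ := hMdec ((v : X) - G v)
  obtain ⟨L₁, hL₁, h0₁, hle₁⟩ := hres u₁ (hsub _ hu₁)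
  obtain ⟨L₂, hL₂, h0₂, hle₂⟩ := hres u₂ (hsub _ hu₂)
  have hwK : ∀ u ∈ K, (∫ s in Ioi (0:ℝ), Real.exp (-s) • V s u) ∈ K := fun u hu =>
    hK.integral_mem _ _ ((ae_restrict_iff' measurableSet_Ioi).2
      (Eventually.of_forall fun s hs => hK.smul _ (Real.exp_pos _).le _
        (hVK s (le_of_lt hs) u hu)))
  set w₁ := ∫ s in Ioi (0:ℝ), Real.exp (-s) • V s u₁ with hw₁
  set w₂ := ∫ s in Ioi (0:ℝ), Real.exp (-s) • V s u₂ with hw₂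
  have hw₁K : w₁ ∈ K := hwK u₁ (hsub _ hu₁)
  have hw₂K : w₂ ∈ K := hwK u₂ (hsub _ hu₂)
  have hv : (v : X) = w₁ - w₂ := by
    rw [← res_gen hVs hC hGV v, hu, hw₁, hw₂,
      ← integral_sub (res_int hVs hC u₁) (res_int hVs hC u₂)]
    simp only [map_sub, smul_sub]
  have hαv : ∀ n t, 0 ≤ t → α n t v = α n t w₁ - α n t w₂ := fun n t ht => by
    rw [hv, hαsub n t _ _ ht]
  have hlim : Tendsto (fun t => t⁻¹ * ∑' n, α n t (v : X)) (𝓝[>] 0) (𝓝 (L₁ - L₂)) := by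
    refine (hL₁.sub hL₂).congr' ?_
    filter_upwards [self_mem_nhdsWithin] with t ht
    have ht : 0 ≤ t := le_of_lt ht
    simp only [fun n => hαv n t ht]
    rw [(hsummK t w₁ ht hw₁K).tsum_sub (hsummK t w₂ ht hw₂K), mul_sub]
  refine ⟨fun t ht => ?_, L₁ - L₂, hlim, ?_, ?_⟩
  · have := (hsummK t w₁ ht.le hw₁K).sub (hsummK t w₂ ht.le hw₂K)
    exact this.congr fun n => (hαv n t ht.le).symm
  · have h1 : ‖(v : X) - G v‖ ≤ ‖(v : X)‖ + ‖G v‖ := norm_sub_le _ _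
    have h2 : M * ‖(v : X) - G v‖ ≤ M * (‖(v : X)‖ + ‖G v‖) :=
      mul_le_mul_of_nonneg_left h1 hM.le
    have h3 : 0 ≤ M * (‖(v : X)‖ + ‖G v‖) := by positivity
    rw [abs_le]
    constructor <;> linarith
  · intro hv0
    have hvK : (v : X) ∈ K := hsub _ hv0
    refine ⟨?_, ?_⟩
    · have h1 := ((Ψ.continuous.tendsto _).comp (hGV.2 v)).neg
      refine le_of_tendsto_of_tendsto hlim h1 ?_
      filter_upwards [self_mem_nhdsWithin] with t ht
      have ht : 0 < t := ht
      simp only [Function.comp, map_smul, smul_eq_mul]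
      rw [← mul_neg, ← map_neg, neg_sub]
      exact mul_le_mul_of_nonneg_left (htsumle t v ht.le hvK) (inv_nonneg.2 ht.le)
    · exact (neg_le_abs _).trans (hΨle _)
end
end

section
/- Given u ∈ X₊, the following statements are equivalent: (1) the trajectory (V(t)u)_{t≥0} is mild honest, i.e., ‖V(t)u‖ = ‖u‖ − â(∫₀ᵗ V(s)u ds) for all t ≥ 0; (2) lim_{n→∞} ‖B ∫₀ᵗ V_n(s)u ds‖ = 0 for every t > 0; (3) ∫₀ᵗ V(s)u ds ∈ D(cl(A+B)) for every t > 0, where cl(A+B) is the closure of (A+B, D(A)); (4) the set {B ∫₀ᵗ V_n(s)u ds : n ∈ ℕ} is relatively weakly compact in X for every t > 0. -/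
open Filter Topology Set MeasureTheory

noncomputable section

variable {X : Type*} [NormedAddCommGroup X] [NormedSpace ℝ X] [CompleteSpace X] [PartialOrder X]

/-- The functional `â(v) = lim_{t→0⁺} (1/t) Σₙ a(∫₀ᵗ Vₙ(s)v ds)` defined through the
Dyson–Phillips iterates. -/
def ahatFun (Ψ : X →L[ℝ] ℝ) (A : X →ₗ.[ℝ] X) (B : A.domain →ₗ[ℝ] X)
    (Vn : ℕ → ℝ → X →L[ℝ] X)
    (memInt : ∀ (n : ℕ) (t : ℝ) (u : X), (∫ s in (0:ℝ)..t, Vn n s u) ∈ A.domain)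
    (v : X) : ℝ :=
  limUnder (𝓝[>] (0:ℝ)) fun t =>
    t⁻¹ * ∑' n : ℕ, aFun Ψ A B ⟨∫ s in (0:ℝ)..t, Vn n s v, memInt n t v⟩

section helpers

variable {Y : Type*} [NormedAddCommGroup Y] [NormedSpace ℝ Y]
variable {Z : Type*} [NormedAddCommGroup Z] [NormedSpace ℝ Z]

lemma hx_locbdd [CompleteSpace Z] (T : ℝ → Z →L[ℝ] Y) (hT : ∀ x, Continuous fun t => T t x) (a b : ℝ) :
    ∃ M : ℝ, 0 ≤ M ∧ ∀ t ∈ Icc a b, ‖T t‖ ≤ M := by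
  obtain ⟨M, hM⟩ := banach_steinhaus (g := fun t : Icc a b => T t) (by
    intro x
    obtain ⟨c, hc⟩ := (isCompact_Icc (a := a) (b := b)).exists_bound_of_continuousOn
      (hT x).continuousOn
    exact ⟨c, fun i => hc i i.2⟩)
  exact ⟨max M 0, le_max_right _ _, fun t ht => (hM ⟨t, ht⟩).trans (le_max_left _ _)⟩

lemma hx_joint [CompleteSpace Z] (T : ℝ → Z →L[ℝ] Y) (hT : ∀ x, Continuous fun t => T t x) :
    Continuous fun p : ℝ × Z => T p.1 p.2 := by
  rw [continuous_iff_continuousAt]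
  rintro ⟨t0, x0⟩
  obtain ⟨M, hM0, hM⟩ := hx_locbdd T hT (t0 - 1) (t0 + 1)
  have h1 : Tendsto (fun p : ℝ × Z => M * ‖p.2 - x0‖ + ‖T p.1 x0 - T t0 x0‖) (𝓝 (t0, x0))
      (𝓝 (M * ‖x0 - x0‖ + ‖T t0 x0 - T t0 x0‖)) := by
    have : Continuous (fun p : ℝ × Z => M * ‖p.2 - x0‖ + ‖T p.1 x0 - T t0 x0‖) := by
      have := (hT x0).comp (continuous_fst (X := ℝ) (Y := Z))
      simp only [Function.comp_def] at this
      fun_prop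
    exact this.tendsto (t0, x0)
  simp only [sub_self, norm_zero, mul_zero, add_zero] at h1
  rw [ContinuousAt, tendsto_iff_norm_sub_tendsto_zero]
  refine squeeze_zero' (Eventually.of_forall fun _ => norm_nonneg _) ?_ h1
  have h2 : ∀ᶠ p : ℝ × Z in 𝓝 (t0, x0), p.1 ∈ Icc (t0 - 1) (t0 + 1) :=
    (continuous_fst.tendsto (t0, x0)).eventually (Icc_mem_nhds (by simp) (by simp))
  filter_upwards [h2] with p hp
  have : T p.1 p.2 - T t0 x0 = T p.1 (p.2 - x0) + (T p.1 x0 - T t0 x0) := by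
    rw [map_sub]; abel
  rw [this]
  refine (norm_add_le _ _).trans (add_le_add ?_ le_rfl)
  exact ((T p.1).le_opNorm _).trans (mul_le_mul_of_nonneg_right (hM _ hp) (norm_nonneg _))

/-- integral family -/
lemma hx_exW [CompleteSpace Z] (T : ℝ → Z →L[ℝ] Y) (hT : ∀ x, Continuous fun t => T t x) :
    ∃ W : ℝ → Z →L[ℝ] Y, ∀ t x, W t x = ∫ s in (0:ℝ)..(max t 0), T s x := by
  have : ∀ t, ∃ W : Z →L[ℝ] Y, ∀ x, W x = ∫ s in (0:ℝ)..(max t 0), T s x := by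
    intro t
    obtain ⟨M, hM0, hM⟩ := hx_locbdd T hT 0 (max t 0)
    refine ⟨LinearMap.mkContinuous
      { toFun := fun x => ∫ s in (0:ℝ)..(max t 0), T s x
        map_add' := ?_
        map_smul' := ?_ } (M * |max t 0 - 0|) ?_, fun x => rfl⟩
    · intro x y
      simp only [map_add]
      exact intervalIntegral.integral_add ((hT x).intervalIntegrable _ _)
        ((hT y).intervalIntegrable _ _)
    · intro c x
      simp only [map_smul, RingHom.id_apply]
      exact intervalIntegral.integral_smul _ _
    · intro x
      refine (intervalIntegral.norm_integral_le_of_norm_le_const (C := M * ‖x‖) ?_).trans ?_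
      · intro s hs
        rw [uIoc_of_le (le_max_right _ _)] at hs
        exact ((T s).le_opNorm _).trans
          (mul_le_mul_of_nonneg_right (hM _ ⟨hs.1.le, hs.2⟩) (norm_nonneg _))
      · apply le_of_eq; ring
  choose W hW using this
  exact ⟨W, hW⟩

/-- triangle Fubini -/
lemma hx_triangle (F : ℝ → ℝ → Y) (hF : Continuous fun p : ℝ × ℝ => F p.1 p.2)
    (t : ℝ) (ht : 0 ≤ t) :
    ∫ r in (0:ℝ)..t, ∫ s in (0:ℝ)..r, F r s = ∫ s in (0:ℝ)..t, ∫ r in s..t, F r s := by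
  have e1 : ∀ r ∈ Icc 0 t, ∫ s in (0:ℝ)..r, F r s
      = ∫ s in (0:ℝ)..t, ({p : ℝ × ℝ | p.2 ≤ p.1}.indicator (fun p => F p.1 p.2) (r, s)) := by
    intro r hr
    rw [intervalIntegral.integral_of_le hr.1, intervalIntegral.integral_of_le ht]
    rw [show (fun s => {p : ℝ × ℝ | p.2 ≤ p.1}.indicator (fun p => F p.1 p.2) (r, s))
      = (Iic r).indicator (fun s => F r s) by
        ext s; simp [indicator]]
    rw [setIntegral_indicator measurableSet_Iic]
    congr 2
    ext x; simp only [mem_Ioc, mem_inter_iff, mem_Iic]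
    constructor
    · rintro ⟨a, b⟩; exact ⟨⟨a, b.trans hr.2⟩, b⟩
    · rintro ⟨⟨a, _⟩, b⟩; exact ⟨a, b⟩
  have e2 : ∀ s ∈ Icc 0 t, ∫ r in s..t, F r s
      = ∫ r in (0:ℝ)..t, ({p : ℝ × ℝ | p.2 ≤ p.1}.indicator (fun p => F p.1 p.2) (r, s)) := by
    intro s hs
    rw [intervalIntegral.integral_of_le hs.2, intervalIntegral.integral_of_le ht]
    rw [show (fun r => {p : ℝ × ℝ | p.2 ≤ p.1}.indicator (fun p => F p.1 p.2) (r, s))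
      = (Ici s).indicator (fun r => F r s) by
        ext r; simp [indicator]]
    rw [← integral_Icc_eq_integral_Ioc, ← integral_Icc_eq_integral_Ioc,
      setIntegral_indicator measurableSet_Ici]
    congr 2
    ext x; simp only [mem_Icc, mem_inter_iff, mem_Ici]
    constructor
    · rintro ⟨a, b⟩; exact ⟨⟨hs.1.trans a, b⟩, a⟩
    · rintro ⟨⟨_, a⟩, b⟩; exact ⟨b, a⟩
  rw [intervalIntegral.integral_congr (g := fun r => ∫ s in (0:ℝ)..t,
    ({p : ℝ × ℝ | p.2 ≤ p.1}.indicator (fun p => F p.1 p.2) (r, s)))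
    (by rw [uIcc_of_le ht]; exact e1)]
  rw [intervalIntegral.integral_congr (a := 0) (b := t) (f := fun s => ∫ r in s..t, F r s)
    (g := fun s => ∫ r in (0:ℝ)..t,
    ({p : ℝ × ℝ | p.2 ≤ p.1}.indicator (fun p => F p.1 p.2) (r, s)))
    (by rw [uIcc_of_le ht]; exact e2)]
  rw [intervalIntegral.integral_of_le ht, intervalIntegral.integral_of_le ht]
  simp only [intervalIntegral.integral_of_le ht]
  rw [integral_integral_swap]
  rw [Measure.prod_restrict]
  have hm : MeasurableSet {p : ℝ × ℝ | p.2 ≤ p.1} := (isClosed_le continuous_snd continuous_fst).measurableSet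
  have : (Function.uncurry fun r s => {p : ℝ × ℝ | p.2 ≤ p.1}.indicator (fun p => F p.1 p.2) (r, s))
     = {p : ℝ × ℝ | p.2 ≤ p.1}.indicator (fun p => F p.1 p.2) := by
    ext ⟨r, s⟩; rfl
  rw [this]
  refine Integrable.indicator ?_ hm
  have : IntegrableOn (fun p : ℝ × ℝ => F p.1 p.2) (Icc 0 t ×ˢ Icc 0 t) (volume.prod volume) :=
    hF.continuousOn.integrableOn_compact (isCompact_Icc.prod isCompact_Icc)
  exact this.mono_set (Set.prod_mono Ioc_subset_Icc_self Ioc_subset_Icc_self)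

lemma hx_conv (F : ℝ → ℝ → Y) (hF : Continuous fun p : ℝ × ℝ => F p.1 p.2)
    (t : ℝ) (ht : 0 ≤ t) :
    ∫ r in (0:ℝ)..t, ∫ s in (0:ℝ)..r, F (r - s) s
      = ∫ s in (0:ℝ)..t, ∫ r in (0:ℝ)..(t - s), F r s := by
  rw [hx_triangle (fun r s => F (r - s) s) (hF.comp
    (by fun_prop : Continuous fun p : ℝ × ℝ => (p.1 - p.2, p.2))) t ht]
  refine intervalIntegral.integral_congr fun s _ => ?_
  rw [intervalIntegral.integral_comp_sub_right (fun r => F r s) s, sub_self]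

end helpers

section semigroup

lemma sg_cont {T : ℝ → X →L[ℝ] X} (hT : ∀ u : X, ContinuousOn (fun t => T t u) (Ici (0 : ℝ)))
    (x : X) : Continuous fun t => T (max t 0) x := by
  have := (hT x).comp_continuous (f := fun t : ℝ => max t 0) (by fun_prop)
    (fun t => mem_Ici.2 (le_max_right t 0))
  exact this

lemma hx_prim {Y : Type*} [NormedAddCommGroup Y] [NormedSpace ℝ Y] [CompleteSpace Y]
    (c : ℝ → Y) (hc : Continuous c) (t : ℝ) :
    Tendsto (fun h : ℝ => h⁻¹ • ((∫ s in (0:ℝ)..(t + h), c s) - ∫ s in (0:ℝ)..t, c s))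
      (𝓝[>] 0) (𝓝 (c t)) :=
  (hc.integral_hasStrictDerivAt 0 t).hasDerivAt.tendsto_slope_zero_right

lemma sg_shift {T : ℝ → X →L[ℝ] X} (hT : IsC0Semigroup T) (x : X) (t h : ℝ) (ht : 0 ≤ t)
    (hh : 0 ≤ h) : T h (∫ s in (0:ℝ)..t, T (max s 0) x)
      = (∫ s in (0:ℝ)..(t + h), T (max s 0) x) - ∫ s in (0:ℝ)..h, T (max s 0) x := by
  have hc := sg_cont hT.strongCont x
  rw [← ContinuousLinearMap.intervalIntegral_comp_comm _ (hc.intervalIntegrable _ _)]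
  rw [intervalIntegral.integral_interval_sub_left (hc.intervalIntegrable _ _)
    (hc.intervalIntegrable _ _)]
  have := intervalIntegral.integral_comp_add_right (a := 0) (b := t)
    (fun s => T (max s 0) x) h
  rw [zero_add] at this
  rw [← this]
  refine intervalIntegral.integral_congr fun s hs => ?_
  rw [uIcc_of_le ht] at hs
  have hs0 : 0 ≤ s := hs.1
  simp only [max_eq_left hs0, max_eq_left (add_nonneg hs0 hh)]
  rw [add_comm s h, hT.map_add h s hh hs0]; rfl

lemma sg_int {T : ℝ → X →L[ℝ] X} (hT : IsC0Semigroup T) {H : X →ₗ.[ℝ] X}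
    (hH : IsGeneratorOf H T) (x : X) (t : ℝ) (ht : 0 ≤ t) :
    ∃ h : (∫ s in (0:ℝ)..t, T (max s 0) x) ∈ H.domain, H ⟨_, h⟩ = T t x - x := by
  have hc := sg_cont hT.strongCont x
  have key : Tendsto (fun h : ℝ => h⁻¹ • (T h (∫ s in (0:ℝ)..t, T (max s 0) x)
      - ∫ s in (0:ℝ)..t, T (max s 0) x)) (𝓝[>] 0) (𝓝 (T t x - x)) := by
    have h1 := hx_prim _ hc t
    have h2 := hx_prim _ hc 0
    have h3 := h1.sub h2
    simp only [max_eq_left ht, max_self, hT.map_zero, ContinuousLinearMap.id_apply] at h3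
    refine h3.congr' ?_
    filter_upwards [self_mem_nhdsWithin] with h hh
    rw [sg_shift hT x t h ht (le_of_lt hh)]
    simp only [zero_add, intervalIntegral.integral_same, sub_zero]
    rw [← smul_sub]; congr 1; abel
  have hm := (hH.1 _).2 ⟨_, key⟩
  exact ⟨hm, tendsto_nhds_unique (hH.2 ⟨_, hm⟩) key⟩

lemma sg_inv {T : ℝ → X →L[ℝ] X} (hT : IsC0Semigroup T) {H : X →ₗ.[ℝ] X}
    (hH : IsGeneratorOf H T) (f : H.domain) (t : ℝ) (ht : 0 ≤ t) :
    ∃ h : T t (f : X) ∈ H.domain, H ⟨_, h⟩ = T t (H f) := by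
  have key : Tendsto (fun h : ℝ => h⁻¹ • (T h (T t (f : X)) - T t (f : X)))
      (𝓝[>] 0) (𝓝 (T t (H f))) := by
    have := ((T t).continuous.tendsto _).comp (hH.2 f)
    refine this.congr' ?_
    filter_upwards [self_mem_nhdsWithin] with h hh
    have hh : 0 ≤ h := le_of_lt hh
    have e : T h (T t (f : X)) = T t (T h (f : X)) := by
      rw [← ContinuousLinearMap.comp_apply, ← hT.map_add h t hh ht, add_comm,
        hT.map_add t h ht hh]; rfl
    simp [e]
  have hm := (hH.1 _).2 ⟨_, key⟩
  exact ⟨hm, tendsto_nhds_unique (hH.2 ⟨_, hm⟩) key⟩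

lemma sg_ftc {T : ℝ → X →L[ℝ] X} (hT : IsC0Semigroup T) {H : X →ₗ.[ℝ] X}
    (hH : IsGeneratorOf H T) (f : H.domain) (t : ℝ) (ht : 0 ≤ t) :
    ∫ s in (0:ℝ)..t, T (max s 0) (H f) = T t (f : X) - f := by
  have hc := sg_cont hT.strongCont (f : X)
  have hc' := sg_cont hT.strongCont (H f)
  have := intervalIntegral.integral_eq_sub_of_hasDeriv_right (a := 0) (b := t)
    (f := fun s => T (max s 0) (f : X)) (f' := fun s => T (max s 0) (H f)) hc.continuousOn
    ?_ (hc'.intervalIntegrable _ _)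
  · rw [this]; simp [max_eq_left ht, hT.map_zero]
  intro s hs
  rw [min_eq_left ht, max_eq_right ht] at hs
  have hs0 : 0 ≤ s := hs.1.le
  rw [hasDerivWithinAt_iff_tendsto_slope' (by simp)]
  have h1 := ((T s).continuous.tendsto _).comp (hH.2 f)
  have h2 : Tendsto (fun r : ℝ => r - s) (𝓝[>] s) (𝓝[>] 0) := by
    refine tendsto_nhdsWithin_iff.2 ⟨?_, ?_⟩
    · have : Tendsto (fun r : ℝ => r - s) (𝓝 s) (𝓝 (s - s)) :=
        (continuous_id.sub continuous_const).tendsto s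
      rw [sub_self] at this
      exact this.mono_left nhdsWithin_le_nhds
    · filter_upwards [self_mem_nhdsWithin] with r hr
      exact sub_pos.2 (mem_Ioi.1 hr)
  have h3 := h1.comp h2
  simp only [max_eq_left hs0]
  refine h3.congr' ?_
  filter_upwards [self_mem_nhdsWithin] with r hr
  have hr : s < r := hr
  have e : T r (f : X) = T s (T (r - s) (f : X)) := by
    rw [← ContinuousLinearMap.comp_apply, ← hT.map_add s (r - s) hs0 (by linarith)]
    congr 2; ring
  simp only [Function.comp_def, slope_def_module, max_eq_left hs0, max_eq_left (hs0.trans hr.le)]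
  rw [e, map_smul, map_sub]

lemma sg_closed {T : ℝ → X →L[ℝ] X} (hT : IsC0Semigroup T) {H : X →ₗ.[ℝ] X}
    (hH : IsGeneratorOf H T) {f : ℕ → H.domain} {v w : X}
    (hf : Tendsto (fun n => (f n : X)) atTop (𝓝 v))
    (hw : Tendsto (fun n => H (f n)) atTop (𝓝 w)) :
    ∃ h : v ∈ H.domain, H ⟨v, h⟩ = w := by
  obtain ⟨W, hW⟩ := hx_exW (fun t => T (max t 0)) (sg_cont hT.strongCont)
  have e : ∀ t, 0 ≤ t → ∫ s in (0:ℝ)..t, T (max s 0) w = T t v - v := by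
    intro t ht
    have h1 := (((W t).continuous.tendsto _).comp hw)
    have h2 := (((T t).continuous.tendsto _).comp hf).sub hf
    have h3 : ∀ n, W t (H (f n)) = T t (f n : X) - f n := by
      intro n
      rw [hW, max_eq_left ht]
      exact sg_ftc hT hH (f n) t ht
    have h4 := tendsto_nhds_unique (h1.congr fun n => h3 n) h2
    rw [hW, max_eq_left ht] at h4
    exact h4
  have key : Tendsto (fun h : ℝ => h⁻¹ • (T h v - v)) (𝓝[>] 0) (𝓝 w) := by
    have h1 := hx_prim _ (sg_cont hT.strongCont w) 0
    simp only [max_self, hT.map_zero, ContinuousLinearMap.id_apply] at h1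
    refine h1.congr' ?_
    filter_upwards [self_mem_nhdsWithin] with h hh
    rw [zero_add, intervalIntegral.integral_same, sub_zero, e h (le_of_lt hh)]
  have hm := (hH.1 _).2 ⟨_, key⟩
  exact ⟨hm, tendsto_nhds_unique (hH.2 ⟨_, hm⟩) key⟩

end semigroup

section core

open Classical in
/-- total extension of a partially defined map -/
def exD (D : Submodule ℝ X) (L : D →ₗ[ℝ] X) (x : X) : X := if h : x ∈ D then L ⟨x, h⟩ else 0

lemma exD_of {D : Submodule ℝ X} (L : D →ₗ[ℝ] X) {x : X} (h : x ∈ D) : exD D L x = L ⟨x, h⟩ := by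
  simp [exD, h]

lemma exD_add {D : Submodule ℝ X} (L : D →ₗ[ℝ] X) {x y : X} (hx : x ∈ D) (hy : y ∈ D) :
    exD D L (x + y) = exD D L x + exD D L y := by
  rw [exD_of L hx, exD_of L hy, exD_of L (D.add_mem hx hy), ← map_add]; rfl

lemma exD_sub {D : Submodule ℝ X} (L : D →ₗ[ℝ] X) {x y : X} (hx : x ∈ D) (hy : y ∈ D) :
    exD D L (x - y) = exD D L x - exD D L y := by
  rw [exD_of L hx, exD_of L hy, exD_of L (D.sub_mem hx hy), ← map_sub]; rfl

lemma exD_smul {D : Submodule ℝ X} (L : D →ₗ[ℝ] X) {x : X} (c : ℝ) (hx : x ∈ D) :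
    exD D L (c • x) = c • exD D L x := by
  rw [exD_of L hx, exD_of L (D.smul_mem c hx), ← map_smul]; rfl

lemma exD_zero {D : Submodule ℝ X} (L : D →ₗ[ℝ] X) : exD D L 0 = 0 := by
  rw [exD_of L D.zero_mem]; exact map_zero L

lemma exD_sum {D : Submodule ℝ X} (L : D →ₗ[ℝ] X) {ι : Type*} (s : Finset ι) (f : ι → X)
    (hf : ∀ i, f i ∈ D) : exD D L (∑ i ∈ s, f i) = ∑ i ∈ s, exD D L (f i) := by
  classical
  induction s using Finset.induction_on with
  | empty => simp [exD_zero]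
  | insert i s hi ih =>
    rw [Finset.sum_insert hi, Finset.sum_insert hi, exD_add L (hf i) (D.sum_mem fun j _ => hf j), ih]

structure Core (D : Submodule ℝ X) (La Lb : D →ₗ[ℝ] X) (Ψ : X →L[ℝ] ℝ) (C : Set X)
    (P W : ℕ → ℝ → X →L[ℝ] X) (Q : ℝ → X →L[ℝ] X) : Prop where
  Cclosed : IsClosed C
  Cadd : ∀ x ∈ C, ∀ y ∈ C, x + y ∈ C
  Czero : (0 : X) ∈ C
  Csmul : ∀ c : ℝ, 0 ≤ c → ∀ x ∈ C, c • x ∈ C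
  Cgen : ∀ x : X, ∃ v ∈ C, ∃ w ∈ C, x = v - w
  CΨ : ∀ x ∈ C, Ψ x = ‖x‖
  Pcont : ∀ n x, Continuous fun t => P n t x
  Pneg : ∀ n t, P n t = P n (max t 0)
  Ppos : ∀ n t, ∀ x ∈ C, P n t x ∈ C
  Qcont : ∀ x, Continuous fun t => Q t x
  Qneg : ∀ t, Q t = Q (max t 0)
  Qpos : ∀ t, ∀ x ∈ C, Q t x ∈ C
  Qle : ∀ t, ∀ x ∈ C, ‖Q t x‖ ≤ ‖x‖
  Q0 : ∀ x, Q 0 x = x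
  Qadd : ∀ s t, 0 ≤ s → 0 ≤ t → ∀ x, Q (s + t) x = Q s (Q t x)
  P00 : ∀ x, P 0 0 x = x
  P0add : ∀ s t, 0 ≤ s → 0 ≤ t → ∀ x, P 0 (s + t) x = P 0 s (P 0 t x)
  sum : ∀ t x, Tendsto (fun n : ℕ => ∑ k ∈ Finset.range (n + 1), P k t x) atTop (𝓝 (Q t x))
  Wdef : ∀ n t x, W n t x = ∫ s in (0:ℝ)..(max t 0), P n s x
  Wmem : ∀ n t x, W n t x ∈ D
  AW0 : ∀ t x, exD D La (W 0 t x) = P 0 t x - x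
  P0mem : ∀ t, ∀ f ∈ D, P 0 t f ∈ D
  AP0 : ∀ t, ∀ f ∈ D, exD D La (P 0 t f) = P 0 t (exD D La f)
  prec : ∀ n t, 0 ≤ t → ∀ f ∈ D,
    P (n + 1) t f = ∫ s in (0:ℝ)..t, P n (t - s) (exD D Lb (P 0 s f))
  Aclosed : ∀ (f : ℕ → X) (v w : X), (∀ n, f n ∈ D) → Tendsto f atTop (𝓝 v) →
    Tendsto (fun n => exD D La (f n)) atTop (𝓝 w) → v ∈ D ∧ exD D La v = w
  Bbdd : ∃ M : ℝ, ∀ f ∈ D, ‖exD D Lb f‖ ≤ M * (‖f‖ + ‖exD D La f‖)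
  diss : ∀ f ∈ D, f ∈ C → Ψ (exD D La f + exD D Lb f) ≤ 0
  Gcl : ∀ (f : ℕ → X) (w u : X) (t : ℝ), 0 ≤ t → (∀ n, f n ∈ D) →
    Tendsto f atTop (𝓝 (∫ s in (0:ℝ)..t, Q s u)) →
    Tendsto (fun n => exD D La (f n) + exD D Lb (f n)) atTop (𝓝 w) → w = Q t u - u

namespace Core

variable {D : Submodule ℝ X} {La Lb : D →ₗ[ℝ] X} {Ψ : X →L[ℝ] ℝ} {C : Set X}
    {P W : ℕ → ℝ → X →L[ℝ] X} {Q : ℝ → X →L[ℝ] X}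

lemma Btend (h : Core D La Lb Ψ C P W Q) {ι : Type*} {l : Filter ι} {f : ι → X} {v : X}
    (hf : ∀ i, f i ∈ D) (hv : v ∈ D) (h1 : Tendsto f l (𝓝 v))
    (h2 : Tendsto (fun i => exD D La (f i)) l (𝓝 (exD D La v))) :
    Tendsto (fun i => exD D Lb (f i)) l (𝓝 (exD D Lb v)) := by
  obtain ⟨M, hM⟩ := h.Bbdd
  rw [tendsto_iff_norm_sub_tendsto_zero] at h1 h2 ⊢
  have h3 := (h1.add h2).const_mul M
  simp only [add_zero, mul_zero] at h3
  refine squeeze_zero (fun _ => norm_nonneg _) (fun i => ?_) h3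
  rw [← exD_sub Lb (hf i) hv, ← exD_sub La (hf i) hv]
  exact hM _ (D.sub_mem (hf i) hv)

lemma Bcont (h : Core D La Lb Ψ C P W Q) {Z : Type*} [TopologicalSpace Z] {f : Z → X}
    (hf : ∀ i, f i ∈ D) (h1 : Continuous f) (h2 : Continuous fun z => exD D La (f z)) :
    Continuous fun z => exD D Lb (f z) := by
  rw [continuous_iff_continuousAt] at *
  exact fun z => h.Btend hf (hf z) (h1 z) (h2 z)

lemma int (h : Core D La Lb Ψ C P W Q) {f : ℝ → X}
    (hf : ∀ i, f i ∈ D) (h1 : Continuous f) (h2 : Continuous fun z => exD D La (f z)) (a b : ℝ) :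
    (∫ s in a..b, f s) ∈ D ∧ exD D La (∫ s in a..b, f s) = ∫ s in a..b, exD D La (f s) ∧
    exD D Lb (∫ s in a..b, f s) = ∫ s in a..b, exD D Lb (f s) := by
  -- graph as a closed submodule
  let Γ : Submodule ℝ (X × X) :=
    { carrier := {p | p.1 ∈ D ∧ exD D La p.1 = p.2}
      add_mem' := by
        rintro ⟨x, y⟩ ⟨x', y'⟩ ⟨a1, a2⟩ ⟨b1, b2⟩
        exact ⟨D.add_mem a1 b1, by simp only [Prod.mk_add_mk] at *; rw [exD_add La a1 b1, a2, b2]⟩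
      zero_mem' := ⟨D.zero_mem, exD_zero La⟩
      smul_mem' := by
        rintro c ⟨x, y⟩ ⟨a1, a2⟩
        exact ⟨D.smul_mem c a1, by simp only [Prod.smul_mk] at *; rw [exD_smul La c a1, a2]⟩ }
  have hΓ : IsClosed (Γ : Set (X × X)) := by
    rw [← isSeqClosed_iff_isClosed]
    intro p q hp hq
    have q1 := (continuous_fst.tendsto q).comp hq
    have q2 := (continuous_snd.tendsto q).comp hq
    exact h.Aclosed (fun n => (p n).1) q.1 q.2 (fun n => (hp n).1) q1
      (q2.congr fun n => ((hp n).2).symm)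
  have : CompleteSpace Γ := hΓ.completeSpace_coe
  let F : ℝ → Γ := fun s => ⟨(f s, exD D La (f s)), hf s, rfl⟩
  have hF : Continuous F := (h1.prodMk h2).subtype_mk _
  have hI := hF.intervalIntegrable (μ := volume) a b
  obtain ⟨M, hM⟩ := h.Bbdd
  let Bl : Γ →ₗ[ℝ] X :=
    { toFun := fun p => exD D Lb p.1.1
      map_add' := fun p q => exD_add Lb p.2.1 q.2.1
      map_smul' := fun c p => exD_smul Lb c p.2.1 }
  let Bc : Γ →L[ℝ] X := Bl.mkContinuous (|M| * 2) (by
    intro p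
    refine (hM _ p.2.1).trans ?_
    have e1 : ‖p.1.1‖ ≤ ‖p‖ := norm_fst_le p.1
    have e2 : ‖exD D La p.1.1‖ ≤ ‖p‖ := by rw [p.2.2]; exact norm_snd_le p.1
    have : M ≤ |M| := le_abs_self M
    calc M * (‖p.1.1‖ + ‖exD D La p.1.1‖) ≤ |M| * (‖p.1.1‖ + ‖exD D La p.1.1‖) := by gcongr
      _ ≤ |M| * (‖p‖ + ‖p‖) := by gcongr
      _ = |M| * 2 * ‖p‖ := by ring)
  have k1 := ContinuousLinearMap.intervalIntegral_comp_comm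
    ((ContinuousLinearMap.fst ℝ X X).comp Γ.subtypeL) hI
  have k2 := ContinuousLinearMap.intervalIntegral_comp_comm
    ((ContinuousLinearMap.snd ℝ X X).comp Γ.subtypeL) hI
  have k3 := ContinuousLinearMap.intervalIntegral_comp_comm Bc hI
  have k1' : ∫ s in a..b, f s = (∫ s in a..b, F s : Γ).1.1 := k1
  have k2' : ∫ s in a..b, exD D La (f s) = (∫ s in a..b, F s : Γ).1.2 := k2
  have k3' : ∫ s in a..b, exD D Lb (f s) = exD D Lb (∫ s in a..b, F s : Γ).1.1 := k3
  rw [k2', k3', k1']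
  exact ⟨(∫ s in a..b, F s : Γ).2.1, (∫ s in a..b, F s : Γ).2.2, rfl⟩

lemma Pj (h : Core D La Lb Ψ C P W Q) (n : ℕ) : Continuous fun p : ℝ × X => P n p.1 p.2 :=
  hx_joint _ (h.Pcont n)

lemma Wcont (h : Core D La Lb Ψ C P W Q) (n : ℕ) (x : X) : Continuous fun t => W n t x := by
  simp only [h.Wdef]
  exact (intervalIntegral.continuous_primitive (fun a b => (h.Pcont n x).intervalIntegrable a b)
    0).comp (by fun_prop : Continuous fun t : ℝ => max t 0)

lemma Wj (h : Core D La Lb Ψ C P W Q) (n : ℕ) : Continuous fun p : ℝ × X => W n p.1 p.2 :=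
  hx_joint _ (h.Wcont n)

lemma W_of (h : Core D La Lb Ψ C P W Q) (n : ℕ) {t : ℝ} (ht : 0 ≤ t) (x : X) :
    W n t x = ∫ s in (0:ℝ)..t, P n s x := by rw [h.Wdef, max_eq_left ht]

lemma Wmax (h : Core D La Lb Ψ C P W Q) (n : ℕ) (t : ℝ) (x : X) :
    W n t x = W n (max t 0) x := by rw [h.Wdef, h.Wdef]; simp

lemma W0 (h : Core D La Lb Ψ C P W Q) (n : ℕ) (x : X) :
    W n 0 x = 0 := by rw [h.Wdef]; simp

lemma Wslope (h : Core D La Lb Ψ C P W Q) (n : ℕ) (x : X) :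
    Tendsto (fun t : ℝ => t⁻¹ • W n t x) (𝓝[>] 0) (𝓝 (P n 0 x)) := by
  have h1 := hx_prim _ (h.Pcont n x) 0
  refine h1.congr' ?_
  filter_upwards [self_mem_nhdsWithin] with t ht
  rw [zero_add, intervalIntegral.integral_same, sub_zero, h.W_of n (le_of_lt ht)]

lemma dense (h : Core D La Lb Ψ C P W Q) : Dense (D : Set X) := by
  intro x
  have := h.Wslope 0 x
  rw [h.P00] at this
  exact mem_closure_of_tendsto this
    (Eventually.of_forall fun t => D.smul_mem _ (h.Wmem _ _ _))

lemma P0f_cont (h : Core D La Lb Ψ C P W Q) {f : X} (hf : f ∈ D) :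
    Continuous fun s => exD D Lb (P 0 s f) := by
  refine h.Bcont (fun s => h.P0mem s f hf) (h.Pcont 0 f) ?_
  simp only [h.AP0 _ f hf]
  exact h.Pcont 0 _

lemma PT0 (h : Core D La Lb Ψ C P W Q) (n : ℕ) (x : X) : P (n + 1) 0 x = 0 := by
  have : (fun x => P (n+1) 0 x) = fun _ => 0 := by
    refine Continuous.ext_on h.dense (P (n+1) 0).continuous continuous_const fun f hf => ?_
    rw [h.prec n 0 le_rfl f hf, intervalIntegral.integral_same]
  exact congrFun this x

lemma Wconv (h : Core D La Lb Ψ C P W Q) (n : ℕ) {t : ℝ} (ht : 0 ≤ t) {f : X} (hf : f ∈ D) :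
    W (n + 1) t f = ∫ s in (0:ℝ)..t, W n (t - s) (exD D Lb (P 0 s f)) := by
  have hg := h.P0f_cont hf
  have := hx_conv (fun a b => P n a (exD D Lb (P 0 b f)))
    ((h.Pj n).comp (continuous_fst.prodMk (hg.comp continuous_snd))) t ht
  rw [h.W_of _ ht]
  calc _ = _ := intervalIntegral.integral_congr (fun r hr => by
          rw [uIcc_of_le ht] at hr
          exact h.prec n r hr.1 f hf)
    _ = _ := this
    _ = _ := intervalIntegral.integral_congr (fun s hs => by
          rw [uIcc_of_le ht] at hs
          exact (h.W_of n (sub_nonneg.2 hs.2) _).symm)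

lemma Wconv2 (h : Core D La Lb Ψ C P W Q) (n : ℕ) {t : ℝ} (ht : 0 ≤ t) {f : X} (hf : f ∈ D) :
    W (n + 1) t f = ∫ s in (0:ℝ)..t, P n (t - s) (exD D Lb (W 0 s f)) := by
  have hg := h.P0f_cont hf
  have := hx_conv (fun a b => P n b (exD D Lb (P 0 a f)))
    ((h.Pj n).comp (continuous_snd.prodMk (hg.comp continuous_fst))) t ht
  have hk : ∀ s, 0 ≤ s → exD D Lb (W 0 s f) = ∫ r in (0:ℝ)..s, exD D Lb (P 0 r f) := by
    intro s hs
    rw [h.W_of 0 hs]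
    refine (h.int (fun s => h.P0mem s f hf) (h.Pcont 0 f) ?_ 0 s).2.2
    simp only [h.AP0 _ f hf]
    exact h.Pcont 0 _
  rw [h.W_of _ ht]
  calc _ = _ := intervalIntegral.integral_congr (fun r hr => by
          rw [uIcc_of_le ht] at hr
          exact (h.prec n r hr.1 f hf).trans (by
            have := intervalIntegral.integral_comp_sub_left (a := 0) (b := r)
              (fun s => P n s (exD D Lb (P 0 (r - s) f))) r
            simp only [sub_sub_cancel, sub_self, sub_zero] at this
            exact this))
    _ = _ := this
    _ = ∫ s in (0:ℝ)..t, P n s (exD D Lb (W 0 (t - s) f)) :=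
        intervalIntegral.integral_congr (fun s hs => by
          rw [uIcc_of_le ht] at hs
          rw [hk _ (sub_nonneg.2 hs.2),
            ContinuousLinearMap.intervalIntegral_comp_comm _ (hg.intervalIntegrable _ _)])
    _ = _ := by
        have := intervalIntegral.integral_comp_sub_left (a := 0) (b := t)
              (fun s => P n s (exD D Lb (W 0 (t - s) f))) t
        simp only [sub_sub_cancel, sub_self, sub_zero] at this
        exact this.symm

lemma AWstep (h : Core D La Lb Ψ C P W Q) (n : ℕ)
    (hc : Continuous fun p : ℝ × X => exD D La (W n p.1 p.2))
    (hi : ∀ t, 0 ≤ t → ∀ f ∈ D, ∫ s in (0:ℝ)..t, (exD D La (W n (t - s) (exD D Lb (P 0 s f)))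
        - P n (t - s) (exD D Lb (P 0 s f))) = - exD D Lb (W n t f)) (t : ℝ) (x : X) :
    exD D La (W (n + 1) t x) = P (n + 1) t x - exD D Lb (W n t x) := by
  have main : ∀ t, 0 ≤ t → exD D La (W (n + 1) t x) = P (n + 1) t x - exD D Lb (W n t x) := by
    intro t ht
    have hD : ∀ f ∈ D, exD D La (W (n + 1) t f) = P (n + 1) t f - exD D Lb (W n t f) := by
      intro f hf
      have hg := h.P0f_cont hf
      have hk : Continuous fun s : ℝ => (t - s, exD D Lb (P 0 s f)) := by fun_prop
      have e1 := (h.int (f := fun s => W n (t - s) (exD D Lb (P 0 s f)))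
        (fun s => h.Wmem _ _ _) ((h.Wj n).comp hk) (hc.comp hk) 0 t).2.1
      have c1 : Continuous fun s : ℝ => P n (t - s) (exD D Lb (P 0 s f)) := (h.Pj n).comp hk
      have c2 : Continuous fun s : ℝ => exD D La (W n (t - s) (exD D Lb (P 0 s f))) := hc.comp hk
      rw [h.Wconv n ht hf, e1, sub_eq_add_neg, ← hi t ht f hf, h.prec n t ht f hf,
        intervalIntegral.integral_sub (c2.intervalIntegrable _ _) (c1.intervalIntegrable _ _)]
      abel
    obtain ⟨f, hfD, hf⟩ := mem_closure_iff_seq_limit.1 (h.dense x)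
    have b1 : Tendsto (fun k => exD D Lb (W n t (f k))) atTop (𝓝 (exD D Lb (W n t x))) := by
      refine h.Btend (fun _ => h.Wmem _ _ _) (h.Wmem _ _ _) (((W n t).continuous.tendsto _).comp hf) ?_
      exact ((hc.comp (by fun_prop : Continuous fun x : X => (t, x))).tendsto x).comp hf
    refine (h.Aclosed (fun k => W (n+1) t (f k)) _ _ (fun _ => h.Wmem _ _ _)
      (((W (n+1) t).continuous.tendsto _).comp hf) ?_).2
    refine Tendsto.congr (fun k => (hD (f k) (hfD k)).symm) ?_
    exact (((P (n+1) t).continuous.tendsto _).comp hf).sub b1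
  rw [h.Wmax, h.Pneg, h.Wmax n]
  exact main _ (le_max_right _ _)

lemma AWind (h : Core D La Lb Ψ C P W Q) (n : ℕ) :
    (Continuous fun p : ℝ × X => exD D La (W n p.1 p.2)) ∧
    (∀ t, 0 ≤ t → ∀ f ∈ D, ∫ s in (0:ℝ)..t, (exD D La (W n (t - s) (exD D Lb (P 0 s f)))
        - P n (t - s) (exD D Lb (P 0 s f))) = - exD D Lb (W n t f)) := by
  induction n with
  | zero =>
    refine ⟨?_, ?_⟩
    · simp only [h.AW0]
      exact (h.Pj 0).sub continuous_snd
    · intro t ht f hf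
      simp only [h.AW0, sub_sub_cancel_left, intervalIntegral.integral_neg]
      rw [h.W_of 0 ht]
      congr 1
      refine ((h.int (fun s => h.P0mem s f hf) (h.Pcont 0 f) ?_ 0 t).2.2).symm
      simp only [h.AP0 _ f hf]
      exact h.Pcont 0 _
  | succ n ih =>
    have hF := h.AWstep n ih.1 ih.2
    refine ⟨?_, ?_⟩
    · simp only [hF]
      exact (h.Pj (n+1)).sub (h.Bcont (fun _ => h.Wmem _ _ _) (h.Wj n) ih.1)
    · intro t ht f hf
      simp only [hF, sub_sub_cancel_left, intervalIntegral.integral_neg]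
      congr 1
      have hg := h.P0f_cont hf
      have hk : Continuous fun s : ℝ => (t - s, exD D Lb (P 0 s f)) := by fun_prop
      rw [h.Wconv n ht hf]
      exact ((h.int (f := fun s => W n (t - s) (exD D Lb (P 0 s f)))
        (fun s => h.Wmem _ _ _) ((h.Wj n).comp hk) (ih.1.comp hk) 0 t).2.2).symm

lemma AW (h : Core D La Lb Ψ C P W Q) (n : ℕ) (t : ℝ) (x : X) :
    exD D La (W (n + 1) t x) = P (n + 1) t x - exD D Lb (W n t x) :=
  h.AWstep n (h.AWind n).1 (h.AWind n).2 t x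

lemma AWj (h : Core D La Lb Ψ C P W Q) (n : ℕ) :
    Continuous fun p : ℝ × X => exD D La (W n p.1 p.2) := (h.AWind n).1

lemma BWj (h : Core D La Lb Ψ C P W Q) (n : ℕ) :
    Continuous fun p : ℝ × X => exD D Lb (W n p.1 p.2) :=
  h.Bcont (fun _ => h.Wmem _ _ _) (h.Wj n) (h.AWj n)

lemma WE (h : Core D La Lb Ψ C P W Q) (n : ℕ) {t : ℝ} (ht : 0 ≤ t) (x : X) :
    W (n + 1) t x = ∫ s in (0:ℝ)..t, P n (t - s) (exD D Lb (W 0 s x)) := by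
  have : (fun x => W (n+1) t x) = fun x => ∫ s in (0:ℝ)..t, P n (t - s) (exD D Lb (W 0 s x)) := by
    refine Continuous.ext_on h.dense (W (n+1) t).continuous ?_ fun f hf => h.Wconv2 n ht hf
    refine intervalIntegral.continuous_parametric_intervalIntegral_of_continuous' ?_ _ _
    have h1 : Continuous fun p : X × ℝ => exD D Lb (W 0 p.2 p.1) :=
      (h.BWj 0).comp (by fun_prop : Continuous fun p : X × ℝ => (p.2, p.1))
    exact (h.Pj n).comp (by fun_prop : Continuous fun p : X × ℝ => (t - p.2, exD D Lb (W 0 p.2 p.1)))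
  exact congrFun this x

lemma right (h : Core D La Lb Ψ C P W Q) (n : ℕ) {t : ℝ} (ht : 0 ≤ t) {f : X} (hf : f ∈ D) :
    W (n + 1) t (exD D La f) + W n t (exD D Lb f) = P (n + 1) t f := by
  have hg := h.P0f_cont hf
  have e : ∀ s, 0 ≤ s → W 0 s (exD D La f) = P 0 s f - f := by
    intro s hs
    rw [← h.AW0, h.W_of 0 hs, h.W_of 0 hs]
    have := (h.int (fun s => h.P0mem s f hf) (h.Pcont 0 f) (by
      simp only [h.AP0 _ f hf]
      exact h.Pcont 0 _) 0 s).2.1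
    simp only [h.AP0 _ f hf] at this
    exact this.symm
  have c1 : Continuous fun s : ℝ => P n (t - s) (exD D Lb (P 0 s f)) :=
    (h.Pj n).comp (by fun_prop : Continuous fun s : ℝ => (t - s, exD D Lb (P 0 s f)))
  have c2 : Continuous fun s : ℝ => P n (t - s) (exD D Lb f) :=
    (h.Pj n).comp (by fun_prop : Continuous fun s : ℝ => (t - s, exD D Lb f))
  rw [h.WE n ht, h.prec n t ht f hf]
  have e2 : ∫ s in (0:ℝ)..t, P n (t - s) (exD D Lb (W 0 s (exD D La f)))
      = ∫ s in (0:ℝ)..t, (P n (t - s) (exD D Lb (P 0 s f)) - P n (t - s) (exD D Lb f)) := by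
    refine intervalIntegral.integral_congr fun s hs => ?_
    rw [uIcc_of_le ht] at hs
    rw [e s hs.1, exD_sub Lb (h.P0mem _ _ hf) hf, map_sub]
  rw [e2, intervalIntegral.integral_sub (c1.intervalIntegrable _ _) (c2.intervalIntegrable _ _)]
  have := intervalIntegral.integral_comp_sub_left (a := 0) (b := t)
              (fun s => P n s (exD D Lb f)) t
  simp only [sub_self, sub_zero] at this
  rw [this, h.W_of n ht]
  abel

lemma Bpos (h : Core D La Lb Ψ C P W Q) {f : X} (hf : f ∈ D) (hfC : f ∈ C) :
    exD D Lb f ∈ C := by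
  have h1 := (h.Wslope 1 (exD D La f)).add (h.Wslope 0 (exD D Lb f))
  rw [h.PT0 0, h.P00, zero_add] at h1
  refine h.Cclosed.mem_of_tendsto h1 ?_
  filter_upwards [self_mem_nhdsWithin] with t ht
  have ht : 0 < t := ht
  rw [← smul_add, h.right 0 ht.le hf]
  exact h.Csmul _ (by positivity) _ (h.Ppos _ _ _ hfC)

lemma Cint (h : Core D La Lb Ψ C P W Q) {c : ℝ → X} (hc : Continuous c) (hC : ∀ s, c s ∈ C)
    {a b : ℝ} (hab : a ≤ b) : ∫ s in a..b, c s ∈ C := by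
  rcases hab.eq_or_lt with rfl | hlt
  · rw [intervalIntegral.integral_same]; exact h.Czero
  have conv : Convex ℝ C := by
    intro x hx y hy p q hp hq _
    exact h.Cadd _ (h.Csmul p hp x hx) _ (h.Csmul q hq y hy)
  have := conv.set_average_mem (μ := volume) (t := Ioc a b) (f := c) h.Cclosed (by simp [hlt]) (by simp)
    (Eventually.of_forall hC) ((hc.integrableOn_Icc).mono_set Ioc_subset_Icc_self)
  have e : ∫ s in a..b, c s = (b - a) • ⨍ s in Ioc a b, c s := by
    rw [setAverage_eq, intervalIntegral.integral_of_le hab, smul_smul]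
    simp only [Measure.real, Real.volume_Ioc, ENNReal.toReal_ofReal (sub_nonneg.2 hab)]
    rw [mul_inv_cancel₀ (sub_ne_zero.2 hlt.ne'), one_smul]
  rw [e]
  exact h.Csmul _ (sub_nonneg.2 hab) _ this

lemma Wpos (h : Core D La Lb Ψ C P W Q) (n : ℕ) (t : ℝ) {x : X} (hx : x ∈ C) : W n t x ∈ C := by
  rw [h.Wdef]
  exact h.Cint (h.Pcont n x) (fun s => h.Ppos n s x hx) (le_max_right _ _)

lemma Kpos (h : Core D La Lb Ψ C P W Q) (n : ℕ) (t : ℝ) {x : X} (hx : x ∈ C) :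
    exD D Lb (W n t x) ∈ C := h.Bpos (h.Wmem _ _ _) (h.Wpos n t hx)

lemma exK (h : Core D La Lb Ψ C P W Q) (n : ℕ) (t : ℝ) :
    ∃ K : X →L[ℝ] X, ∀ x, K x = exD D Lb (W n t x) :=
  ⟨{ toFun := fun x => exD D Lb (W n t x)
     map_add' := fun x y => by rw [map_add, exD_add Lb (h.Wmem _ _ _) (h.Wmem _ _ _)]
     map_smul' := fun c x => by rw [map_smul, exD_smul Lb _ (h.Wmem _ _ _)]; rfl
     cont := (h.BWj n).comp (by fun_prop : Continuous fun x : X => (t, x)) }, fun x => rfl⟩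

/-- Dyson-Phillips addition formula -/
lemma DP (h : Core D La Lb Ψ C P W Q) (n : ℕ) {t s : ℝ} (ht : 0 ≤ t) (hs : 0 ≤ s) (x : X) :
    P n (t + s) x = ∑ k ∈ Finset.range (n + 1), P (n - k) t (P k s x) := by
  induction n generalizing x s with
  | zero => simp [h.P0add t s ht hs x]
  | succ n ih =>
    have : (fun x => P (n+1) (t + s) x)
        = fun x => ∑ k ∈ Finset.range (n + 1 + 1), P (n + 1 - k) t (P k s x) := by
      refine Continuous.ext_on h.dense (P (n+1) (t+s)).continuous (by fun_prop) fun f hf => ?_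
      have hg := h.P0f_cont hf
      have c1 : Continuous fun r : ℝ => P n (t + s - r) (exD D Lb (P 0 r f)) :=
        (h.Pj n).comp (by fun_prop : Continuous fun r : ℝ => (t + s - r, exD D Lb (P 0 r f)))
      rw [h.prec n (t + s) (by positivity) f hf,
        ← intervalIntegral.integral_add_adjacent_intervals (b := s) (c1.intervalIntegrable _ _)
          (c1.intervalIntegrable _ _)]
      rw [Finset.sum_range_succ']
      congr 1
      · have : ∀ k, P (n - k) t (P (k+1) s f)
            = ∫ r in (0:ℝ)..s, P (n - k) t (P k (s - r) (exD D Lb (P 0 r f))) := by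
          intro k
          have c2 : Continuous fun r : ℝ => P k (s - r) (exD D Lb (P 0 r f)) :=
            (h.Pj k).comp (by fun_prop : Continuous fun r : ℝ => (s - r, exD D Lb (P 0 r f)))
          rw [ContinuousLinearMap.intervalIntegral_comp_comm _ (c2.intervalIntegrable _ _),
            h.prec k s hs f hf]
        simp only [Nat.add_sub_add_right, this]
        rw [← intervalIntegral.integral_finsetSum]
        · refine intervalIntegral.integral_congr fun r hr => ?_
          rw [uIcc_of_le hs] at hr
          rw [add_sub_assoc, ih (sub_nonneg.2 hr.2)]
        · intro k _
          have c2 : Continuous fun r : ℝ => P k (s - r) (exD D Lb (P 0 r f)) :=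
            (h.Pj k).comp (by fun_prop : Continuous fun r : ℝ => (s - r, exD D Lb (P 0 r f)))
          exact ((P (n-k) t).continuous.comp c2).intervalIntegrable _ _
      · rw [Nat.sub_zero, h.prec _ t ht _ (h.P0mem s f hf)]
        have := intervalIntegral.integral_comp_add_right (a := 0) (b := t)
          (fun r => P n (t + s - r) (exD D Lb (P 0 r f))) s
        rw [zero_add] at this
        rw [← this]
        refine intervalIntegral.integral_congr fun r hr => ?_
        rw [uIcc_of_le ht] at hr
        rw [add_sub_add_right_eq_sub, h.P0add r s hr.1 hs]
    exact congrFun this x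

lemma WDP (h : Core D La Lb Ψ C P W Q) (n : ℕ) {t s : ℝ} (ht : 0 ≤ t) (hs : 0 ≤ s) (x : X) :
    W n (t + s) x = W n s x + ∑ k ∈ Finset.range (n + 1), W (n - k) t (P k s x) := by
  have c := h.Pcont n x
  rw [h.W_of n (add_nonneg ht hs), h.W_of n hs,
    ← intervalIntegral.integral_add_adjacent_intervals (b := s) (c.intervalIntegrable _ _)
          (c.intervalIntegrable _ _)]
  congr 1
  have := intervalIntegral.integral_comp_add_right (a := 0) (b := t) (fun r => P n r x) s
  rw [zero_add] at this
  rw [← this]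
  simp only [h.W_of _ ht]
  rw [← intervalIntegral.integral_finsetSum]
  · refine intervalIntegral.integral_congr fun r hr => ?_
    rw [uIcc_of_le ht] at hr
    exact h.DP n hr.1 hs x
  · intro k _
    exact (h.Pcont _ _).intervalIntegrable _ _

/-- the functional a(W_n(t)x) -/
def al (D : Submodule ℝ X) (La Lb : D →ₗ[ℝ] X) (Ψ : X →L[ℝ] ℝ) (x : X) : ℝ :=
  -Ψ (exD D La x + exD D Lb x)

lemma al_add {x y : X} (hx : x ∈ D) (hy : y ∈ D) :
    al D La Lb Ψ (x + y) = al D La Lb Ψ x + al D La Lb Ψ y := by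
  simp only [al, exD_add La hx hy, exD_add Lb hx hy, map_add]; ring

lemma al_sub {x y : X} (hx : x ∈ D) (hy : y ∈ D) :
    al D La Lb Ψ (x - y) = al D La Lb Ψ x - al D La Lb Ψ y := by
  simp only [al, exD_sub La hx hy, exD_sub Lb hx hy, map_add, map_sub]; ring

lemma al_sum {ι : Type*} (s : Finset ι) (f : ι → X) (hf : ∀ i, f i ∈ D) :
    al D La Lb Ψ (∑ i ∈ s, f i) = ∑ i ∈ s, al D La Lb Ψ (f i) := by
  simp only [al, exD_sum La s f hf, exD_sum Lb s f hf, map_add, map_sum, Finset.sum_neg_distrib,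
    Finset.sum_add_distrib]

lemma star (h : Core D La Lb Ψ C P W Q) (N : ℕ) (t : ℝ) (x : X) :
    exD D La (∑ n ∈ Finset.range (N + 1), W n t x) + exD D Lb (∑ n ∈ Finset.range (N + 1), W n t x)
      = ∑ n ∈ Finset.range (N + 1), P n t x - x + exD D Lb (W N t x) := by
  rw [exD_sum La _ _ (fun n => h.Wmem n t x), exD_sum Lb _ _ (fun n => h.Wmem n t x)]
  induction N with
  | zero => simp [h.AW0]
  | succ N ih =>
    rw [Finset.sum_range_succ, Finset.sum_range_succ (fun n => exD D Lb (W n t x)),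
      Finset.sum_range_succ (fun n => P n t x), h.AW, add_add_add_comm, ih]
    abel

lemma al_nonneg (h : Core D La Lb Ψ C P W Q) (n : ℕ) (t : ℝ) {x : X} (hx : x ∈ C) :
    0 ≤ al D La Lb Ψ (W n t x) :=
  neg_nonneg.2 (h.diss _ (h.Wmem _ _ _) (h.Wpos _ _ hx))

lemma al_partial (h : Core D La Lb Ψ C P W Q) (N : ℕ) (t : ℝ) (x : X) :
    ∑ n ∈ Finset.range (N + 1), al D La Lb Ψ (W n t x)
      = Ψ x - Ψ (∑ n ∈ Finset.range (N + 1), P n t x) - Ψ (exD D Lb (W N t x)) := by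
  rw [← al_sum _ _ (fun n => h.Wmem n t x), al, h.star, map_add, map_sub]; ring

lemma Psum_mem (h : Core D La Lb Ψ C P W Q) (s : Finset ℕ) (t : ℝ) {x : X} (hx : x ∈ C) :
    ∑ n ∈ s, P n t x ∈ C := by
  classical
  induction s using Finset.induction_on with
  | empty => simpa using h.Czero
  | insert i s hi ih => rw [Finset.sum_insert hi]; exact h.Cadd _ (h.Ppos _ _ _ hx) _ ih

lemma Ψnn (h : Core D La Lb Ψ C P W Q) {x : X} (hx : x ∈ C) : 0 ≤ Ψ x := by
  rw [h.CΨ x hx]; exact norm_nonneg _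

lemma al_summable (h : Core D La Lb Ψ C P W Q) (t : ℝ) (x : X) :
    Summable fun n => al D La Lb Ψ (W n t x) := by
  have pos : ∀ x ∈ C, Summable fun n => al D La Lb Ψ (W n t x) := by
    intro x hx
    refine summable_of_sum_range_le (c := Ψ x) (fun n => h.al_nonneg n t hx) fun N => ?_
    refine (Finset.sum_le_sum_of_subset_of_nonneg
      (Finset.range_mono (Nat.le_succ N)) fun n _ _ => h.al_nonneg n t hx).trans ?_
    rw [Nat.succ_eq_add_one, h.al_partial]
    have := h.Ψnn (h.Psum_mem (Finset.range (N+1)) t hx)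
    have := h.Ψnn (h.Kpos N t hx)
    linarith
  obtain ⟨v, hv, w, hw, rfl⟩ := h.Cgen x
  refine ((pos v hv).sub (pos w hw)).congr fun n => ?_
  rw [map_sub, al_sub (h.Wmem _ _ _) (h.Wmem _ _ _)]

lemma exβ (h : Core D La Lb Ψ C P W Q) : ∃ β : ℝ → X →L[ℝ] ℝ,
    ∀ t x, Tendsto (fun n => Ψ (exD D Lb (W n t x))) atTop (𝓝 (β t x)) ∧
      HasSum (fun n => al D La Lb Ψ (W n t x)) (Ψ x - Ψ (Q t x) - β t x) := by
  have : ∀ t, ∃ β : X →L[ℝ] ℝ,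
      ∀ x, Tendsto (fun n => Ψ (exD D Lb (W n t x))) atTop (𝓝 (β x)) ∧
        HasSum (fun n => al D La Lb Ψ (W n t x)) (Ψ x - Ψ (Q t x) - β x) := by
    intro t
    choose K hK using fun n => h.exK n t
    have lim : ∀ x, Tendsto (fun n => Ψ (exD D Lb (W n t x))) atTop
        (𝓝 (Ψ x - Ψ (Q t x) - ∑' n, al D La Lb Ψ (W n t x))) := by
      intro x
      have h1 := ((h.al_summable t x).hasSum.tendsto_sum_nat).comp (tendsto_add_atTop_nat 1)
      have h2 := (Ψ.continuous.tendsto _).comp (h.sum t x)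
      have h3 := (h2.const_sub (Ψ x)).sub h1
      refine h3.congr fun N => ?_
      simp only [Function.comp_def]
      rw [h.al_partial]; ring
    refine ⟨continuousLinearMapOfTendsto (l := atTop) (fun n => Ψ.comp (K n))
      (f := fun x => Ψ x - Ψ (Q t x) - ∑' n, al D La Lb Ψ (W n t x)) ?_, fun x => ⟨lim x, ?_⟩⟩
    swap
    · have := (h.al_summable t x).hasSum
      convert this using 1
      change Ψ x - Ψ (Q t x) - (Ψ x - Ψ (Q t x) - ∑' n, al D La Lb Ψ (W n t x)) = _
      ring
    rw [tendsto_pi_nhds]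
    intro x
    refine (lim x).congr fun n => ?_
    simp [hK]
  choose β hβ using this
  exact ⟨β, hβ⟩

/-- the limiting loss functional -/
def IsB (D : Submodule ℝ X) (La Lb : D →ₗ[ℝ] X) (Ψ : X →L[ℝ] ℝ)
    (W : ℕ → ℝ → X →L[ℝ] X) (Q : ℝ → X →L[ℝ] X) (β : ℝ → X →L[ℝ] ℝ) : Prop :=
  ∀ t x, Tendsto (fun n => Ψ (exD D Lb (W n t x))) atTop (𝓝 (β t x)) ∧
      HasSum (fun n => al D La Lb Ψ (W n t x)) (Ψ x - Ψ (Q t x) - β t x)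

variable {β : ℝ → X →L[ℝ] ℝ}

lemma K_le (h : Core D La Lb Ψ C P W Q) (n : ℕ) (t : ℝ) {x : X} (hx : x ∈ C) :
    Ψ (exD D Lb (W n t x)) ≤ Ψ x := by
  have h1 := h.al_partial n t x
  have h2 : 0 ≤ ∑ n ∈ Finset.range (n + 1), al D La Lb Ψ (W n t x) :=
    Finset.sum_nonneg fun i _ => h.al_nonneg i t hx
  have := h.Ψnn (h.Psum_mem (Finset.range (n+1)) t hx)
  linarith

lemma K_bd (h : Core D La Lb Ψ C P W Q) (x : X) :
    ∃ c : ℝ, ∀ n t, |Ψ (exD D Lb (W n t x))| ≤ c := by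
  obtain ⟨v, hv, w, hw, rfl⟩ := h.Cgen x
  refine ⟨Ψ v + Ψ w, fun n t => ?_⟩
  rw [map_sub, exD_sub Lb (h.Wmem _ _ _) (h.Wmem _ _ _), map_sub, abs_le]
  have a1 := h.K_le n t hv
  have a2 := h.K_le n t hw
  have a3 := h.Ψnn (h.Kpos n t hv)
  have a4 := h.Ψnn (h.Kpos n t hw)
  constructor <;> linarith

lemma β_nonneg (h : Core D La Lb Ψ C P W Q) (hb : IsB D La Lb Ψ W Q β) (t : ℝ) {x : X}
    (hx : x ∈ C) : 0 ≤ β t x :=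
  ge_of_tendsto' (hb t x).1 fun n => h.Ψnn (h.Kpos n t hx)

lemma β_bd (h : Core D La Lb Ψ C P W Q) (hb : IsB D La Lb Ψ W Q β) (x : X) :
    ∃ c : ℝ, ∀ t, |β t x| ≤ c := by
  obtain ⟨c, hc⟩ := h.K_bd x
  exact ⟨c, fun t => le_of_tendsto' ((hb t x).1.abs) fun n => hc n t⟩

lemma β_unif (h : Core D La Lb Ψ C P W Q) (hb : IsB D La Lb Ψ W Q β) :
    ∃ M : ℝ, ∀ t x, |β t x| ≤ M * ‖x‖ := by
  obtain ⟨M, hM⟩ := banach_steinhaus (g := β) (fun x => h.β_bd hb x)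
  exact ⟨M, fun t x => (β t).le_of_opNorm_le (hM t) x⟩

lemma β_meas (h : Core D La Lb Ψ C P W Q) (hb : IsB D La Lb Ψ W Q β) (x : X) :
    Measurable fun t => β t x := by
  refine measurable_of_tendsto_metrizable (f := fun n t => Ψ (exD D Lb (W n t x))) (fun n => ?_) ?_
  · exact (Ψ.continuous.comp ((h.BWj n).comp (by fun_prop : Continuous fun t : ℝ => (t, x)))).measurable
  · rw [tendsto_pi_nhds]; exact fun t => (hb t x).1

lemma β_int (h : Core D La Lb Ψ C P W Q) (hb : IsB D La Lb Ψ W Q β) (x : X) (a b : ℝ) :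
    IntervalIntegrable (fun t => β t x) volume a b := by
  obtain ⟨c, hc⟩ := h.β_bd hb x
  refine (intervalIntegrable_const (c := c)).mono_fun (h.β_meas hb x).aestronglyMeasurable ?_
  exact Eventually.of_forall fun t => (hc t).trans (le_abs_self c)

lemma α_nonneg (h : Core D La Lb Ψ C P W Q) (hb : IsB D La Lb Ψ W Q β) (t : ℝ) {x : X}
    (hx : x ∈ C) : 0 ≤ Ψ x - Ψ (Q t x) - β t x :=
  (hb t x).2.nonneg fun n => h.al_nonneg n t hx

lemma α_add (h : Core D La Lb Ψ C P W Q) (hb : IsB D La Lb Ψ W Q β) {t s : ℝ} (ht : 0 ≤ t)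
    (hs : 0 ≤ s) {x : X} (hx : x ∈ C) :
    Ψ x - Ψ (Q (t + s) x) - β (t + s) x =
      (Ψ x - Ψ (Q s x) - β s x) + (Ψ (Q s x) - Ψ (Q t (Q s x)) - β t (Q s x)) := by
  let g : ℕ × ℕ → ℝ := fun p => al D La Lb Ψ (W p.2 t (P p.1 s x))
  have g0 : ∀ p, 0 ≤ g p := fun p => h.al_nonneg _ _ (h.Ppos _ _ _ hx)
  let α : X →L[ℝ] ℝ := Ψ - Ψ.comp (Q t) - β t
  have s1 : ∀ k, HasSum (fun m => g (k, m)) (α (P k s x)) := fun k => (hb t (P k s x)).2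
  have s2 : HasSum (fun k => α (P k s x)) (α (Q s x)) := by
    rw [hasSum_iff_tendsto_nat_of_nonneg (fun k => (s1 k).nonneg fun m => g0 _)]
    have := (α.continuous.tendsto _).comp (h.sum s x)
    rw [← tendsto_add_atTop_iff_nat 1]
    refine this.congr fun n => ?_
    simp only [Function.comp_def, map_sum]
  have sg : Summable g := by
    rw [summable_prod_of_nonneg g0]
    refine ⟨fun k => (s1 k).summable, ?_⟩
    simp only [fun k => (s1 k).tsum_eq]
    exact s2.summable
  have e1 : ∑' p, g p = α (Q s x) := (sg.hasSum.prod_fiberwise s1).unique s2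
  have s3 := ((Finset.HasAntidiagonal.sigmaAntidiagonalEquivProd (A := ℕ)).hasSum_iff.2 sg.hasSum).sigma
    (fun n => hasSum_fintype _)
  rw [e1] at s3
  have s4 := ((hb s x).2).add s3
  refine (hb (t + s) x).2.unique ?_
  refine Eq.mp ?_ s4
  congr 1
  funext n
  rw [h.WDP n ht hs, al_add (h.Wmem _ _ _) (D.sum_mem fun _ _ => h.Wmem _ _ _),
    al_sum _ _ (fun _ => h.Wmem _ _ _)]
  congr 1
  rw [← Finset.Nat.sum_antidiagonal_eq_sum_range_succ (fun k m => g (k, m)) n]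
  exact Finset.sum_coe_sort (Finset.HasAntidiagonal.antidiagonal n) (fun ij => g ij)

lemma β_add (h : Core D La Lb Ψ C P W Q) (hb : IsB D La Lb Ψ W Q β) {t s : ℝ} (ht : 0 ≤ t)
    (hs : 0 ≤ s) {x : X} (hx : x ∈ C) : β (t + s) x = β s x + β t (Q s x) := by
  have := h.α_add hb ht hs hx
  rw [h.Qadd t s ht hs] at this
  linarith

lemma hx_cocyc {γ : ℝ → ℝ} (hγ : ∀ a b, IntervalIntegrable γ volume a b) (t τ : ℝ) :
    ∫ s in (0:ℝ)..t, (γ (τ + s) - γ s) =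
      (∫ s in (0:ℝ)..(t + τ), γ s) - (∫ s in (0:ℝ)..τ, γ s) - ∫ s in (0:ℝ)..t, γ s := by
  have e := intervalIntegral.integral_comp_add_left (a := 0) (b := t) γ τ
  have i1 : IntervalIntegrable (fun s => γ (τ + s)) volume 0 t := by
    have := (hγ (0 + τ) (t + τ)).comp_add_right τ
    simp only [add_sub_cancel_right] at this
    refine this.congr ?_
    exact fun s _ => by rw [add_comm τ s]
  rw [intervalIntegral.integral_sub i1 (hγ _ _), e, add_zero, add_comm τ t,
    intervalIntegral.integral_interval_sub_left (hγ _ _) (hγ _ _)]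

lemma Q_meas_bd (h : Core D La Lb Ψ C P W Q) (a b : ℝ) (x : X) :
    IntervalIntegrable (fun s => Q s x) volume a b := (h.Qcont x).intervalIntegrable a b

lemma β_Qint (h : Core D La Lb Ψ C P W Q) (hb : IsB D La Lb Ψ W Q β) {t τ : ℝ} (ht : 0 ≤ t)
    (hτ : 0 ≤ τ) {x : X} (hx : x ∈ C) :
    β τ (∫ s in (0:ℝ)..t, Q s x) =
      (∫ s in (0:ℝ)..(t + τ), β s x) - (∫ s in (0:ℝ)..τ, β s x) - ∫ s in (0:ℝ)..t, β s x := by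
  rw [← ContinuousLinearMap.intervalIntegral_comp_comm _ (h.Q_meas_bd _ _ _),
    ← hx_cocyc (h.β_int hb x)]
  refine intervalIntegral.integral_congr fun s hs => ?_
  rw [uIcc_of_le ht] at hs
  rw [h.β_add hb hτ hs.1 hx]; ring

/-- the functional `α` -/
def αf (Ψ : X →L[ℝ] ℝ) (Q : ℝ → X →L[ℝ] X) (β : ℝ → X →L[ℝ] ℝ) (t : ℝ) : X →L[ℝ] ℝ :=
  Ψ - Ψ.comp (Q t) - β t

lemma αf_int (h : Core D La Lb Ψ C P W Q) (hb : IsB D La Lb Ψ W Q β) (x : X) (a b : ℝ) :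
    IntervalIntegrable (fun t => αf Ψ Q β t x) volume a b :=
  ((continuous_const.sub (Ψ.continuous.comp (h.Qcont x))).intervalIntegrable a b).sub
    (h.β_int hb x a b)

lemma αf_Qint (h : Core D La Lb Ψ C P W Q) (hb : IsB D La Lb Ψ W Q β) {t τ : ℝ} (ht : 0 ≤ t)
    (hτ : 0 ≤ τ) {x : X} (hx : x ∈ C) :
    αf Ψ Q β τ (∫ s in (0:ℝ)..t, Q s x) =
      (∫ s in (0:ℝ)..(t + τ), αf Ψ Q β s x) - (∫ s in (0:ℝ)..τ, αf Ψ Q β s x)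
        - ∫ s in (0:ℝ)..t, αf Ψ Q β s x := by
  rw [← ContinuousLinearMap.intervalIntegral_comp_comm _ (h.Q_meas_bd _ _ _),
    ← hx_cocyc (h.αf_int hb x)]
  refine intervalIntegral.integral_congr fun s hs => ?_
  rw [uIcc_of_le ht] at hs
  have := h.α_add hb hτ hs.1 hx
  simp only [αf, sub_apply, ContinuousLinearMap.comp_apply]
  linarith

lemma αf_small (h : Core D La Lb Ψ C P W Q) (hb : IsB D La Lb Ψ W Q β) {x : X} (hx : x ∈ C) :
    Tendsto (fun s => αf Ψ Q β s x) (𝓝[>] 0) (𝓝 0) := by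
  have h1 : Tendsto (fun s => Ψ x - Ψ (Q s x)) (𝓝[>] 0) (𝓝 (Ψ x - Ψ (Q 0 x))) :=
    ((continuous_const.sub (Ψ.continuous.comp (h.Qcont x))).tendsto 0).mono_left nhdsWithin_le_nhds
  rw [h.Q0, sub_self] at h1
  refine squeeze_zero (fun s => h.α_nonneg hb s hx) (fun s => ?_) h1
  have := h.β_nonneg hb s hx
  simp only [αf, sub_apply, ContinuousLinearMap.comp_apply]
  linarith

lemma αf_rcont (h : Core D La Lb Ψ C P W Q) (hb : IsB D La Lb Ψ W Q β) {x : X} (hx : x ∈ C)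
    {t : ℝ} (ht : 0 ≤ t) : ContinuousWithinAt (fun s => αf Ψ Q β s x) (Ioi t) t := by
  have h1 := h.αf_small hb (h.Qpos t x hx)
  have h2 : Tendsto (fun s : ℝ => s - t) (𝓝[>] t) (𝓝[>] 0) := by
    refine tendsto_nhdsWithin_iff.2 ⟨?_, ?_⟩
    · have : Tendsto (fun s : ℝ => s - t) (𝓝 t) (𝓝 (t - t)) := by
        exact (by fun_prop : Continuous fun s : ℝ => s - t).tendsto t
      rw [sub_self] at this
      exact this.mono_left nhdsWithin_le_nhds
    · filter_upwards [self_mem_nhdsWithin] with s hs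
      exact sub_pos.2 (mem_Ioi.1 hs)
  have h3 := (h1.comp h2).const_add (αf Ψ Q β t x)
  rw [add_zero] at h3
  refine h3.congr' ?_
  filter_upwards [self_mem_nhdsWithin] with s hs
  have hs : t < s := hs
  have := h.α_add hb (sub_pos.2 hs).le ht hx
  rw [sub_add_cancel] at this
  simp only [αf, Function.comp_def, sub_apply, ContinuousLinearMap.comp_apply]
  linarith

lemma αf_zero (h : Core D La Lb Ψ C P W Q) (hb : IsB D La Lb Ψ W Q β) {x : X} (hx : x ∈ C) :
    αf Ψ Q β 0 x = 0 := by
  have h1 := h.α_nonneg hb 0 hx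
  have h2 := h.β_nonneg hb 0 hx
  simp only [αf, sub_apply, ContinuousLinearMap.comp_apply]
  rw [h.Q0] at *
  linarith

lemma αf_slope (h : Core D La Lb Ψ C P W Q) (hb : IsB D La Lb Ψ W Q β) {x : X} (hx : x ∈ C)
    {t : ℝ} (ht : 0 ≤ t) : Tendsto (fun τ : ℝ => τ⁻¹ *
      ((∫ s in (0:ℝ)..(t + τ), αf Ψ Q β s x) - ∫ s in (0:ℝ)..t, αf Ψ Q β s x)) (𝓝[>] 0)
      (𝓝 (αf Ψ Q β t x)) := by
  have hm : Measurable fun s => αf Ψ Q β s x :=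
    ((continuous_const.sub (Ψ.continuous.comp (h.Qcont x))).measurable).sub (h.β_meas hb x)
  have h1 := intervalIntegral.integral_hasDerivWithinAt_right (h.αf_int hb x 0 t)
    (s := Ici t) (t := Ioi t) (hm.stronglyMeasurable.stronglyMeasurableAtFilter)
    (h.αf_rcont hb hx ht)
  have h2 := h1.Ioi_of_Ici
  rw [hasDerivWithinAt_iff_tendsto_slope' (by simp)] at h2
  have h3 : Tendsto (fun s : ℝ => t + s) (𝓝[>] 0) (𝓝[>] t) := by
    refine tendsto_nhdsWithin_iff.2 ⟨?_, ?_⟩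
    · have : Tendsto (fun s : ℝ => t + s) (𝓝 0) (𝓝 (t + 0)) := by
        exact (by fun_prop : Continuous fun s : ℝ => t + s).tendsto 0
      rw [add_zero] at this
      exact this.mono_left nhdsWithin_le_nhds
    · filter_upwards [self_mem_nhdsWithin] with s hs
      have : (0:ℝ) < s := hs
      exact lt_add_of_pos_right t this
  refine (h2.comp h3).congr fun τ => ?_
  simp [slope_def_field, div_eq_inv_mul]

lemma ahat_lim (h : Core D La Lb Ψ C P W Q) (hb : IsB D La Lb Ψ W Q β) {x : X} (hx : x ∈ C)
    {t : ℝ} (ht : 0 ≤ t) : Tendsto (fun τ : ℝ => τ⁻¹ * αf Ψ Q β τ (∫ s in (0:ℝ)..t, Q s x))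
      (𝓝[>] 0) (𝓝 (αf Ψ Q β t x)) := by
  have h1 := (h.αf_slope hb hx ht).sub (h.αf_slope hb hx le_rfl)
  rw [h.αf_zero hb hx, sub_zero] at h1
  refine h1.congr' ?_
  filter_upwards [self_mem_nhdsWithin] with τ hτ
  have hτ : (0:ℝ) < τ := hτ
  rw [h.αf_Qint hb ht hτ.le hx, zero_add, intervalIntegral.integral_same]
  ring

lemma β_D (h : Core D La Lb Ψ C P W Q) (hb : IsB D La Lb Ψ W Q β) {t : ℝ} (ht : 0 ≤ t) {f : X}
    (hf : f ∈ D) : β t f = ∫ s in (0:ℝ)..t, β s (exD D La f + exD D Lb f) := by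
  have cs : ∀ x : X, Continuous fun s : ℝ => (s, x) := fun x => by fun_prop
  have step : ∀ N, Ψ (exD D Lb (W (N + 1) t f)) = ∫ s in (0:ℝ)..t,
      (Ψ (exD D Lb (W (N + 1) s (exD D La f))) + Ψ (exD D Lb (W N s (exD D Lb f)))) := by
    intro N
    have e1 : W (N + 1) t f
        = ∫ s in (0:ℝ)..t, (W (N + 1) s (exD D La f) + W N s (exD D Lb f)) := by
      rw [h.W_of _ ht]
      refine intervalIntegral.integral_congr fun s hs => ?_
      rw [uIcc_of_le ht] at hs
      exact (h.right N hs.1 hf).symm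
    have c1 : Continuous fun s => exD D Lb (W (N + 1) s (exD D La f) + W N s (exD D Lb f)) := by
      simp only [exD_add Lb (h.Wmem _ _ _) (h.Wmem _ _ _)]
      exact ((h.BWj (N+1)).comp (cs (exD D La f))).add ((h.BWj N).comp (cs (exD D Lb f)))
    have := (h.int (f := fun s => W (N + 1) s (exD D La f) + W N s (exD D Lb f))
      (fun s => D.add_mem (h.Wmem _ _ _) (h.Wmem _ _ _))
      (((h.Wj (N+1)).comp (cs (exD D La f))).add ((h.Wj N).comp (cs (exD D Lb f)))) (by
        simp only [exD_add La (h.Wmem _ _ _) (h.Wmem _ _ _)]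
        exact ((h.AWj (N+1)).comp (cs (exD D La f))).add ((h.AWj N).comp (cs (exD D Lb f))))
        0 t).2.2
    rw [e1, this, ← ContinuousLinearMap.intervalIntegral_comp_comm _ (c1.intervalIntegrable _ _)]
    simp only [exD_add Lb (h.Wmem _ _ _) (h.Wmem _ _ _), map_add]
  have l1 := (hb t f).1.comp (tendsto_add_atTop_nat 1)
  refine tendsto_nhds_unique l1 ?_
  simp only [Function.comp_def, step]
  obtain ⟨c1, hc1⟩ := h.K_bd (exD D La f)
  obtain ⟨c2, hc2⟩ := h.K_bd (exD D Lb f)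
  refine intervalIntegral.tendsto_integral_filter_of_dominated_convergence (fun _ => c1 + c2)
    (Eventually.of_forall fun N => ?_) (Eventually.of_forall fun N => Eventually.of_forall
      fun s _ => (abs_add_le _ _).trans (add_le_add (hc1 _ _) (hc2 _ _))) intervalIntegrable_const
    (Eventually.of_forall fun s _ => ?_)
  · exact ((Ψ.continuous.comp ((h.BWj (N+1)).comp (cs (exD D La f)))).add
      (Ψ.continuous.comp ((h.BWj N).comp (cs (exD D Lb f))))).aestronglyMeasurable
  · rw [map_add]
    exact ((hb s _).1.comp (tendsto_add_atTop_nat 1)).add (hb s _).1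

/-- if `∫ Q s u` is in the closure domain, the loss vanishes -/
lemma three_two (h : Core D La Lb Ψ C P W Q) (hb : IsB D La Lb Ψ W Q β) {T : ℝ} (hT : 0 ≤ T)
    {u : X} (hu : u ∈ C) (f : ℕ → X) (w : X) (hf : ∀ n, f n ∈ D)
    (h1 : Tendsto f atTop (𝓝 (∫ s in (0:ℝ)..T, Q s u)))
    (h2 : Tendsto (fun n => exD D La (f n) + exD D Lb (f n)) atTop (𝓝 w)) : β T u = 0 := by
  have hw := h.Gcl f w u T hT hf h1 h2
  subst hw
  obtain ⟨M, hM⟩ := h.β_unif hb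
  have a1 := ((β 1).continuous.tendsto _).comp h1
  have a2 : Tendsto (fun n => β 1 (f n)) atTop (𝓝 (∫ s in (0:ℝ)..1, β s (Q T u - u))) := by
    simp only [h.β_D hb zero_le_one (hf _)]
    rw [tendsto_iff_norm_sub_tendsto_zero] at h2 ⊢
    have h3 := h2.const_mul M
    rw [mul_zero] at h3
    refine squeeze_zero (fun _ => norm_nonneg _) (fun n => ?_) h3
    rw [← intervalIntegral.integral_sub (h.β_int hb _ _ _) (h.β_int hb _ _ _)]
    have := intervalIntegral.norm_integral_le_of_norm_le_const (a := 0) (b := 1)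
      (f := fun s => β s (exD D La (f n) + exD D Lb (f n)) - β s (Q T u - u))
      (C := M * ‖exD D La (f n) + exD D Lb (f n) - (Q T u - u)‖) (fun s _ => by
        rw [← map_sub]; exact hM s _)
    simpa using this
  have e := tendsto_nhds_unique a1 a2
  rw [h.β_Qint hb hT zero_le_one hu] at e
  have e2 : ∫ s in (0:ℝ)..1, β s (Q T u - u)
      = (∫ s in (0:ℝ)..1, (β (T + s) u - β s u)) - β T u := by
    have : ∫ s in (0:ℝ)..1, β s (Q T u - u) = ∫ s in (0:ℝ)..1, ((β (T + s) u - β s u) - β T u) := by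
      refine intervalIntegral.integral_congr fun s hs => ?_
      rw [uIcc_of_le zero_le_one] at hs
      have := h.β_add hb hs.1 hT hu
      simp only [map_sub]
      rw [add_comm T s, this]; ring
    have i1 : IntervalIntegrable (fun s => β (T + s) u - β s u) volume 0 1 := by
      refine IntervalIntegrable.sub ?_ (h.β_int hb _ _ _)
      have := (h.β_int hb u (0 + T) (1 + T)).comp_add_right T
      simp only [add_sub_cancel_right] at this
      refine this.congr ?_
      exact fun s _ => by rw [add_comm T s]
    rw [this, intervalIntegral.integral_sub i1 intervalIntegrable_const]
    simp
  rw [e2, hx_cocyc (h.β_int hb u), add_comm 1 T] at e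
  linarith

lemma Psum_norm (h : Core D La Lb Ψ C P W Q) (N : ℕ) (t : ℝ) {x : X} (hx : x ∈ C) :
    ‖∑ n ∈ Finset.range N, P n t x‖ ≤ ‖x‖ := by
  rw [← h.CΨ _ (h.Psum_mem _ _ hx)]
  have mono : Monotone fun N => Ψ (∑ n ∈ Finset.range N, P n t x) := by
    refine monotone_nat_of_le_succ fun n => ?_
    rw [Finset.sum_range_succ, map_add]
    have := h.Ψnn (h.Ppos n t x hx)
    linarith
  have l := (Ψ.continuous.tendsto _).comp (h.sum t x)
  have l' : Tendsto (fun N => Ψ (∑ n ∈ Finset.range N, P n t x)) atTop (𝓝 (Ψ (Q t x))) := by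
    rw [← tendsto_add_atTop_iff_nat 1]; exact l
  refine (mono.ge_of_tendsto l' N).trans ?_
  rw [h.CΨ _ (h.Qpos t x hx)]
  exact h.Qle t x hx

lemma Wsum (h : Core D La Lb Ψ C P W Q) {t : ℝ} (ht : 0 ≤ t) {x : X} (hx : x ∈ C) :
    Tendsto (fun N => ∑ n ∈ Finset.range (N + 1), W n t x) atTop
      (𝓝 (∫ s in (0:ℝ)..t, Q s x)) := by
  have : ∀ N, ∑ n ∈ Finset.range (N + 1), W n t x
      = ∫ s in (0:ℝ)..t, ∑ n ∈ Finset.range (N + 1), P n s x := by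
    intro N
    rw [intervalIntegral.integral_finsetSum fun n _ => (h.Pcont n x).intervalIntegrable _ _]
    simp only [h.W_of _ ht]
  simp only [this]
  refine intervalIntegral.tendsto_integral_filter_of_dominated_convergence (fun _ => ‖x‖)
    (Eventually.of_forall fun N => ?_) (Eventually.of_forall fun N => Eventually.of_forall
      fun s _ => h.Psum_norm _ s hx) intervalIntegrable_const
    (Eventually.of_forall fun s _ => h.sum s x)
  exact (continuous_finsetSum _ fun n _ => h.Pcont n x).aestronglyMeasurable

lemma two_iff (h : Core D La Lb Ψ C P W Q) (hb : IsB D La Lb Ψ W Q β) (t : ℝ) {u : X}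
    (hu : u ∈ C) : Tendsto (fun n => ‖exD D Lb (W n t u)‖) atTop (𝓝 0) ↔ β t u = 0 := by
  have e : (fun n => ‖exD D Lb (W n t u)‖) = fun n => Ψ (exD D Lb (W n t u)) := by
    funext n; rw [h.CΨ _ (h.Kpos n t hu)]
  rw [e]
  constructor
  · intro h1; exact tendsto_nhds_unique (hb t u).1 h1
  · intro h1; rw [← h1]; exact (hb t u).1

lemma two_three (h : Core D La Lb Ψ C P W Q) {t : ℝ} (ht : 0 ≤ t) {u : X} (hu : u ∈ C)
    (h2 : Tendsto (fun n => ‖exD D Lb (W n t u)‖) atTop (𝓝 0)) :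
    ∃ (f : ℕ → X) (w : X), (∀ n, f n ∈ D) ∧ Tendsto f atTop (𝓝 (∫ s in (0:ℝ)..t, Q s u)) ∧
      Tendsto (fun n => exD D La (f n) + exD D Lb (f n)) atTop (𝓝 w) := by
  refine ⟨fun N => ∑ n ∈ Finset.range (N + 1), W n t u, Q t u - u + 0,
    fun N => D.sum_mem fun _ _ => h.Wmem _ _ _, h.Wsum ht hu, ?_⟩
  simp only [h.star]
  exact ((h.sum t u).sub_const u).add (tendsto_zero_iff_norm_tendsto_zero.2 h2)

lemma two_four {x : ℕ → X} (h2 : Tendsto (fun n => ‖x n‖) atTop (𝓝 0)) :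
    IsCompact (closure ((toWeakSpace ℝ X) '' (Set.range x))) := by
  have h1 : Tendsto x atTop (𝓝 0) := tendsto_zero_iff_norm_tendsto_zero.2 h2
  have k := h1.isCompact_insert_range
  have k2 := k.image (toWeakSpaceCLM ℝ X).continuous
  refine k2.closure_of_subset ?_
  rintro _ ⟨y, hy, rfl⟩
  exact ⟨y, Or.inr hy, rfl⟩

lemma four_three (h : Core D La Lb Ψ C P W Q) {t : ℝ} (ht : 0 ≤ t) {u : X} (hu : u ∈ C)
    (h4 : IsCompact (closure ((toWeakSpace ℝ X) '' (Set.range fun n => exD D Lb (W n t u))))) :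
    ∃ (f : ℕ → X) (w : X), (∀ n, f n ∈ D) ∧ Tendsto f atTop (𝓝 (∫ s in (0:ℝ)..t, Q s u)) ∧
      Tendsto (fun n => exD D La (f n) + exD D Lb (f n)) atTop (𝓝 w) := by
  obtain ⟨y', -, hy⟩ := h4.exists_mapClusterPt (f := (atTop : Filter ℕ))
    (u := fun n : ℕ => toWeakSpace ℝ X (exD D Lb (W n t u))) (by
      refine Filter.le_principal_iff.2 ?_
      exact mem_map.2 (univ_mem' fun n => subset_closure ⟨_, ⟨n, rfl⟩, rfl⟩))
  obtain ⟨y, rfl⟩ := (toWeakSpace ℝ X).surjective y'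
  let Γ : Submodule ℝ (X × X) :=
    { carrier := {p | p.1 ∈ D ∧ exD D La p.1 + exD D Lb p.1 = p.2}
      add_mem' := by
        rintro ⟨x, y⟩ ⟨x', y'⟩ ⟨a1, a2⟩ ⟨b1, b2⟩
        refine ⟨D.add_mem a1 b1, ?_⟩
        simp only [Prod.mk_add_mk] at *
        rw [exD_add La a1 b1, exD_add Lb a1 b1, ← a2, ← b2]; abel
      zero_mem' := ⟨D.zero_mem, by simp [exD_zero]⟩
      smul_mem' := by
        rintro c ⟨x, y⟩ ⟨a1, a2⟩
        refine ⟨D.smul_mem c a1, ?_⟩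
        simp only [Prod.smul_mk] at *
        rw [exD_smul La c a1, exD_smul Lb c a1, ← smul_add, a2] }
  have key : ((∫ s in (0:ℝ)..t, Q s u), Q t u - u + y) ∈ Γ.topologicalClosure := by
    by_contra hn
    obtain ⟨φ, s, hφ, hs⟩ := geometric_hahn_banach_closed_point (Γ.topologicalClosure.convex)
      Γ.isClosed_topologicalClosure hn
    let ψ : X →L[ℝ] ℝ := φ.comp (ContinuousLinearMap.inr ℝ X X)
    have c1 : Continuous fun z : WeakSpace ℝ X => ψ ((toWeakSpace ℝ X).symm z) :=
      WeakBilin.eval_continuous _ ψ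
    have m1 := hy.continuousAt_comp c1.continuousAt
    have t1 : Tendsto (fun N => φ (∑ n ∈ Finset.range (N + 1), W n t u,
        ∑ n ∈ Finset.range (N + 1), P n t u - u)) atTop
        (𝓝 (φ ((∫ s in (0:ℝ)..t, Q s u), Q t u - u))) :=
      (φ.continuous.tendsto _).comp ((h.Wsum ht hu).prodMk_nhds ((h.sum t u).sub_const u))
    have add : ∀ a b c : X, φ (a, b + c) = φ (a, b) + ψ c := by
      intro a b c
      change _ = φ (a, b) + φ (0, c)
      rw [← map_add]; simp
    rw [add] at hs
    set L := φ ((∫ s in (0:ℝ)..t, Q s u), Q t u - u)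
    have ev : ∀ᶠ N in atTop, L - (L + ψ y - s) / 2 < φ (∑ n ∈ Finset.range (N + 1), W n t u,
        ∑ n ∈ Finset.range (N + 1), P n t u - u) := t1.eventually (lt_mem_nhds (by linarith))
    have fr : ∃ᶠ N in atTop, ψ y - (L + ψ y - s) / 2 < ψ (exD D Lb (W N t u)) :=
      m1.frequently (lt_mem_nhds (by
        change ψ y - (L + ψ y - s) / 2 < ψ y
        linarith))
    obtain ⟨N, hN1, hN2⟩ := (fr.and_eventually ev).exists
    have hD : ∑ n ∈ Finset.range (N + 1), W n t u ∈ D := D.sum_mem fun n _ => h.Wmem n t u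
    have hmem : (∑ n ∈ Finset.range (N + 1), W n t u,
        ∑ n ∈ Finset.range (N + 1), P n t u - u + exD D Lb (W N t u)) ∈ Γ :=
      ⟨hD, h.star N t u⟩
    have := hφ _ (Γ.le_topologicalClosure hmem)
    rw [add] at this
    linarith
  have key2 : ((∫ s in (0:ℝ)..t, Q s u), Q t u - u + y) ∈ closure (Γ : Set (X × X)) := key
  obtain ⟨p, hp, hl⟩ := mem_closure_iff_seq_limit.1 key2
  refine ⟨fun n => (p n).1, Q t u - u + y, fun n => (hp n).1, (continuous_fst.tendsto _).comp hl, ?_⟩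
  have := (continuous_snd.tendsto _).comp hl
  exact this.congr fun n => (hp n).2.symm

end Core
end core

lemma mkCore
    (hconeadd : ∀ u v : X, 0 ≤ u → 0 ≤ v → 0 ≤ u + v)
    (hconesmul : ∀ (c : ℝ) (u : X), 0 ≤ c → 0 ≤ u → 0 ≤ c • u)
    (hgen : ∀ u : X, ∃ v w : X, 0 ≤ v ∧ 0 ≤ w ∧ u = v - w)
    (Ψ : X →L[ℝ] ℝ) (hΨ : ∀ u : X, 0 ≤ u → Ψ u = ‖u‖)
    (U : ℝ → X →L[ℝ] X) (hU : IsSubstochastic U)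
    (A : X →ₗ.[ℝ] X) (hA : IsGeneratorOf A U)
    (B : A.domain →ₗ[ℝ] X)
    (G : X →ₗ.[ℝ] X) (V : ℝ → X →L[ℝ] X)
    (hV : IsSubstochastic V) (hGV : IsGeneratorOf G V)
    (hGext : ∀ u : A.domain, ∃ h : (u : X) ∈ G.domain, G ⟨(u : X), h⟩ = A u + B u)
    (hUdom : ∀ (s : ℝ), 0 ≤ s → ∀ u : A.domain, U s (u : X) ∈ A.domain)
    (Vn : ℕ → ℝ → X →L[ℝ] X)
    (hVnpos : ∀ (n : ℕ) (t : ℝ), 0 ≤ t → ∀ u : X, 0 ≤ u → 0 ≤ Vn n t u)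
    (hVncont : ∀ (n : ℕ) (u : X), ContinuousOn (fun t => Vn n t u) (Ici (0 : ℝ)))
    (hV0 : Vn 0 = U)
    (hVrec : ∀ (n : ℕ) (t : ℝ), 0 ≤ t → ∀ u : A.domain,
      Vn (n + 1) t (u : X) =
        ∫ s in (0:ℝ)..t,
          Vn n (t - s) (B ⟨U (max s 0) (u : X), hUdom (max s 0) (le_max_right _ _) u⟩))
    (memInt : ∀ (n : ℕ) (t : ℝ) (u : X), (∫ s in (0:ℝ)..t, Vn n s u) ∈ A.domain)
    (hVsum : ∀ (t : ℝ), 0 ≤ t → ∀ u : X,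
      Tendsto (fun n : ℕ => ∑ k ∈ Finset.range (n + 1), Vn k t u) atTop (𝓝 (V t u)))
    (W : ℕ → ℝ → X →L[ℝ] X)
    (hW : ∀ n t x, W n t x = ∫ s in (0:ℝ)..(max t 0), Vn n (max s 0) x) :
    Core A.domain A.toFun B Ψ (closure {x : X | 0 ≤ x}) (fun n t => Vn n (max t 0)) W
      (fun t => V (max t 0)) := by
  have m0 : ∀ t : ℝ, 0 ≤ max t 0 := fun t => le_max_right t 0
  have CΨ : ∀ x ∈ closure {x : X | 0 ≤ x}, Ψ x = ‖x‖ := by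
    intro x hx
    have : closure {x : X | 0 ≤ x} ⊆ {x | Ψ x = ‖x‖} :=
      closure_minimal (fun x hx => hΨ x hx) (isClosed_eq Ψ.continuous continuous_norm)
    exact this hx
  have Qpos : ∀ t : ℝ, ∀ x ∈ closure {x : X | 0 ≤ x}, V (max t 0) x ∈ closure {x : X | 0 ≤ x} :=
    fun t x hx => map_mem_closure (V (max t 0)).continuous hx
      (fun y hy => (hV.2 _ (m0 t) y hy).1)
  have Qle : ∀ t : ℝ, ∀ x ∈ closure {x : X | 0 ≤ x}, ‖V (max t 0) x‖ ≤ ‖x‖ := by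
    intro t x hx
    have : closure {x : X | 0 ≤ x} ⊆ {x | ‖V (max t 0) x‖ ≤ ‖x‖} :=
      closure_minimal (fun x hx => (hV.2 _ (m0 t) x hx).2)
        (isClosed_le (V (max t 0)).continuous.norm continuous_norm)
    exact this hx
  have Aclosed : ∀ (f : ℕ → X) (v w : X), (∀ n, f n ∈ A.domain) → Tendsto f atTop (𝓝 v) →
      Tendsto (fun n => exD A.domain A.toFun (f n)) atTop (𝓝 w) →
      v ∈ A.domain ∧ exD A.domain A.toFun v = w := by
    intro f v w hf h1 h2
    obtain ⟨h, e⟩ := sg_closed hU.1 hA (f := fun n => ⟨f n, hf n⟩) h1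
      (h2.congr fun n => exD_of _ (hf n))
    exact ⟨h, (exD_of _ h).trans e⟩
  have GE : ∀ f : X, ∀ hf : f ∈ A.domain, ∃ h : f ∈ G.domain,
      G ⟨f, h⟩ = exD A.domain A.toFun f + exD A.domain B f := by
    intro f hf
    obtain ⟨h, e⟩ := hGext ⟨f, hf⟩
    refine ⟨h, ?_⟩
    rw [exD_of _ hf, exD_of _ hf]; exact e
  refine
    { Cclosed := isClosed_closure
      Cadd := fun x hx y hy => map_mem_closure₂ continuous_add hx hy
        (fun a ha b hb => hconeadd a b ha hb)
      Czero := subset_closure (le_refl (0:X))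
      Csmul := fun c hc x hx => map_mem_closure (continuous_const_smul c) hx
        (fun y hy => hconesmul c y hc hy)
      Cgen := fun x => by
        obtain ⟨v, w, hv, hw, e⟩ := hgen x
        exact ⟨v, subset_closure hv, w, subset_closure hw, e⟩
      CΨ := CΨ
      Pcont := fun n x => sg_cont (hVncont n) x
      Pneg := fun n t => by simp
      Ppos := fun n t x hx => map_mem_closure (Vn n (max t 0)).continuous hx
        (fun y hy => hVnpos n _ (m0 t) y hy)
      Qcont := fun x => sg_cont hV.1.strongCont x
      Qneg := fun t => by simp
      Qpos := Qpos
      Qle := Qle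
      Q0 := fun x => by simp [hV.1.map_zero]
      Qadd := fun s t hs ht x => by
        simp only [max_eq_left hs, max_eq_left ht, max_eq_left (add_nonneg hs ht)]
        rw [hV.1.map_add s t hs ht]; rfl
      P00 := fun x => by simp [hV0, hU.1.map_zero]
      P0add := fun s t hs ht x => by
        simp only [max_eq_left hs, max_eq_left ht, max_eq_left (add_nonneg hs ht), hV0]
        rw [hU.1.map_add s t hs ht]; rfl
      sum := fun t x => hVsum _ (m0 t) x
      Wdef := hW
      Wmem := ?_
      AW0 := ?_
      P0mem := ?_
      AP0 := ?_
      prec := ?_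
      Aclosed := Aclosed
      Bbdd := ?_
      diss := ?_
      Gcl := ?_ }
  · intro n t x
    have : W n t x = ∫ s in (0:ℝ)..(max t 0), Vn n s x := by
      rw [hW]
      refine intervalIntegral.integral_congr fun s hs => ?_
      rw [uIcc_of_le (m0 t)] at hs
      simp only [max_eq_left hs.1]
    rw [this]; exact memInt _ _ _
  · intro t x
    obtain ⟨h, e⟩ := sg_int hU.1 hA x (max t 0) (m0 t)
    rw [hW, hV0, exD_of _ h]; exact e
  · intro t f hf
    rw [hV0]; exact hUdom _ (m0 t) ⟨f, hf⟩
  · intro t f hf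
    obtain ⟨h, e⟩ := sg_inv hU.1 hA ⟨f, hf⟩ (max t 0) (m0 t)
    rw [hV0, exD_of _ h, exD_of _ hf]; exact e
  · intro n t ht f hf
    have := hVrec n t ht ⟨f, hf⟩
    simp only [max_eq_left ht]
    rw [this]
    refine intervalIntegral.integral_congr fun s hs => ?_
    rw [uIcc_of_le ht] at hs
    have e : max (t - s) 0 = t - s := max_eq_left (sub_nonneg.2 hs.2)
    simp only [e, hV0]
    rw [exD_of B (hUdom (max s 0) (m0 s) ⟨f, hf⟩)]
  · let Γ : Submodule ℝ (X × X) :=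
      { carrier := {p | p.1 ∈ A.domain ∧ exD A.domain A.toFun p.1 = p.2}
        add_mem' := by
          rintro ⟨x, y⟩ ⟨x', y'⟩ ⟨a1, a2⟩ ⟨b1, b2⟩
          exact ⟨A.domain.add_mem a1 b1, by
            simp only [Prod.mk_add_mk] at *; rw [exD_add _ a1 b1, a2, b2]⟩
        zero_mem' := ⟨A.domain.zero_mem, exD_zero _⟩
        smul_mem' := by
          rintro c ⟨x, y⟩ ⟨a1, a2⟩
          exact ⟨A.domain.smul_mem c a1, by
            simp only [Prod.smul_mk] at *; rw [exD_smul _ c a1, a2]⟩ }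
    have hΓ : IsClosed (Γ : Set (X × X)) := by
      rw [← isSeqClosed_iff_isClosed]
      intro p q hp hq
      have q1 := (continuous_fst.tendsto q).comp hq
      have q2 := (continuous_snd.tendsto q).comp hq
      exact Aclosed (fun n => (p n).1) q.1 q.2 (fun n => (hp n).1) q1
        (q2.congr fun n => ((hp n).2).symm)
    have : CompleteSpace Γ := hΓ.completeSpace_coe
    let Bl : Γ →ₗ[ℝ] X :=
      { toFun := fun p => exD A.domain B p.1.1
        map_add' := fun p q => exD_add B p.2.1 q.2.1
        map_smul' := fun c p => exD_smul B c p.2.1 }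
    have hBc : Continuous Bl := by
      refine LinearMap.continuous_of_seq_closed_graph Bl fun p q y hp hy => ?_
      have p0 := (continuous_subtype_val.tendsto q).comp hp
      have p1 := (continuous_fst.tendsto _).comp p0
      have p2 := (continuous_snd.tendsto _).comp p0
      obtain ⟨h, e⟩ := sg_closed hV.1 hGV (f := fun n => ⟨(p n).1.1, (GE _ (p n).2.1).1⟩)
        (v := q.1.1) (w := q.1.2 + y) p1 (by
          refine (p2.add hy).congr fun n => ?_
          rw [(GE _ (p n).2.1).2, (p n).2.2]; rfl)
      have e' := (GE _ q.2.1).2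
      rw [e, q.2.2] at e'
      exact add_left_cancel e'
    let Bc : Γ →L[ℝ] X := ⟨Bl, hBc⟩
    refine ⟨‖Bc‖, fun f hf => ?_⟩
    let p : Γ := ⟨(f, exD A.domain A.toFun f), hf, rfl⟩
    have k := Bc.le_opNorm p
    have k2 : ‖p‖ ≤ ‖f‖ + ‖exD A.domain A.toFun f‖ := by
      change ‖(f, exD A.domain A.toFun f)‖ ≤ _
      rw [Prod.norm_mk]
      exact max_le (le_add_of_nonneg_right (norm_nonneg _)) (le_add_of_nonneg_left (norm_nonneg _))
    calc ‖exD A.domain B f‖ ≤ ‖Bc‖ * ‖p‖ := k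
      _ ≤ _ := by gcongr
  · intro f hf hfC
    obtain ⟨h, e⟩ := GE f hf
    rw [← e]
    have l := (Ψ.continuous.tendsto _).comp (hGV.2 ⟨f, h⟩)
    refine le_of_tendsto l ?_
    filter_upwards [self_mem_nhdsWithin] with t ht
    have ht : (0:ℝ) < t := ht
    have a1 := CΨ _ (Qpos t f hfC)
    have a2 := Qle t f hfC
    rw [max_eq_left ht.le] at a1 a2
    simp only [Function.comp_def, map_smul, map_sub, smul_eq_mul]
    rw [a1, CΨ f hfC]
    exact mul_nonpos_of_nonneg_of_nonpos (by positivity) (by linarith)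
  · intro f w u t ht hf h1 h2
    obtain ⟨h, e⟩ := sg_closed hV.1 hGV (f := fun n => ⟨f n, (GE _ (hf n)).1⟩) h1
      (h2.congr fun n => (GE _ (hf n)).2.symm)
    obtain ⟨h', e'⟩ := sg_int hV.1 hGV u t ht
    rw [← e]
    simp only [max_eq_left ht]
    exact e'

/-- For `u ∈ X₊` the following are equivalent: (1) the trajectory `(V(t)u)` is mild honest;
(2) `‖B ∫₀ᵗ Vₙ(s)u ds‖ → 0` for every `t > 0`; (3) `∫₀ᵗ V(s)u ds ∈ D(cl(A+B))` for every
`t > 0`; (4) `{B ∫₀ᵗ Vₙ(s)u ds}ₙ` is relatively weakly compact for every `t > 0`. -/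
theorem mild_honesty_equivalences
    (hconeadd : ∀ u v : X, 0 ≤ u → 0 ≤ v → 0 ≤ u + v)
    (hconesmul : ∀ (c : ℝ) (u : X), 0 ≤ c → 0 ≤ u → 0 ≤ c • u)
    (hgen : ∀ u : X, ∃ v w : X, 0 ≤ v ∧ 0 ≤ w ∧ u = v - w)
    (haddnorm : ∀ u v : X, 0 ≤ u → 0 ≤ v → ‖u + v‖ = ‖u‖ + ‖v‖)
    (Ψ : X →L[ℝ] ℝ) (hΨ : ∀ u : X, 0 ≤ u → Ψ u = ‖u‖)
    (U : ℝ → X →L[ℝ] X) (hU : IsSubstochastic U)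
    (A : X →ₗ.[ℝ] X) (hA : IsGeneratorOf A U)
    (B : A.domain →ₗ[ℝ] X)
    (hBpos : ∀ u : A.domain, 0 ≤ (u : X) → 0 ≤ B u)
    (hdiss : ∀ u : A.domain, 0 ≤ (u : X) → Ψ (A u + B u) ≤ 0)
    -- the minimal substochastic semigroup V generated by an extension G of A + B
    (G : X →ₗ.[ℝ] X) (V : ℝ → X →L[ℝ] X)
    (hV : IsSubstochastic V) (hGV : IsGeneratorOf G V)
    (hGext : ∀ u : A.domain, ∃ h : (u : X) ∈ G.domain, G ⟨(u : X), h⟩ = A u + B u)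
    -- U leaves D(A) invariant
    (hUdom : ∀ (s : ℝ), 0 ≤ s → ∀ u : A.domain, U s (u : X) ∈ A.domain)
    -- the Dyson-Phillips iterates: V₀ = U, V_{n+1}(t)u = ∫₀ᵗ Vₙ(t-s) B U(s)u ds on D(A),
    -- each extended to a bounded positive operator on X
    (Vn : ℕ → ℝ → X →L[ℝ] X)
    (hVnpos : ∀ (n : ℕ) (t : ℝ), 0 ≤ t → ∀ u : X, 0 ≤ u → 0 ≤ Vn n t u)
    (hVncont : ∀ (n : ℕ) (u : X), ContinuousOn (fun t => Vn n t u) (Ici (0 : ℝ)))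
    (hV0 : Vn 0 = U)
    (hVrec : ∀ (n : ℕ) (t : ℝ), 0 ≤ t → ∀ u : A.domain,
      Vn (n + 1) t (u : X) =
        ∫ s in (0:ℝ)..t,
          Vn n (t - s) (B ⟨U (max s 0) (u : X), hUdom (max s 0) (le_max_right _ _) u⟩))
    -- ∫₀ᵗ Vₙ(s)u ds belongs to D(A)
    (memInt : ∀ (n : ℕ) (t : ℝ) (u : X), (∫ s in (0:ℝ)..t, Vn n s u) ∈ A.domain)
    -- V(t)u = Σₙ Vₙ(t)u
    (hVsum : ∀ (t : ℝ), 0 ≤ t → ∀ u : X,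
      Tendsto (fun n : ℕ => ∑ k ∈ Finset.range (n + 1), Vn k t u) atTop (𝓝 (V t u)))
    (u : X) (hu : 0 ≤ u) :
    -- (1) ↔ (2)
    ((∀ t : ℝ, 0 ≤ t →
        ‖V t u‖ = ‖u‖ - ahatFun Ψ A B Vn memInt (∫ s in (0:ℝ)..t, V s u)) ↔
      (∀ t : ℝ, 0 < t →
        Tendsto (fun n : ℕ => ‖B ⟨∫ s in (0:ℝ)..t, Vn n s u, memInt n t u⟩‖)
          atTop (𝓝 0))) ∧
    -- (2) ↔ (3)
    ((∀ t : ℝ, 0 < t →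
        Tendsto (fun n : ℕ => ‖B ⟨∫ s in (0:ℝ)..t, Vn n s u, memInt n t u⟩‖)
          atTop (𝓝 0)) ↔
      (∀ t : ℝ, 0 < t → InClosureDomain A B (∫ s in (0:ℝ)..t, V s u))) ∧
    -- (3) ↔ (4)
    ((∀ t : ℝ, 0 < t → InClosureDomain A B (∫ s in (0:ℝ)..t, V s u)) ↔
      (∀ t : ℝ, 0 < t → IsCompact (closure ((toWeakSpace ℝ X) ''
        (Set.range fun n : ℕ => B ⟨∫ s in (0:ℝ)..t, Vn n s u, memInt n t u⟩))))) := by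
  choose W hW using fun n => hx_exW (fun t => Vn n (max t 0)) (sg_cont (hVncont n))
  have h := mkCore hconeadd hconesmul hgen Ψ hΨ U hU A hA B G V hV hGV hGext hUdom Vn hVnpos hVncont
    hV0 hVrec memInt hVsum W hW
  obtain ⟨β, hb⟩ := h.exβ
  have hb : Core.IsB A.domain A.toFun B Ψ W (fun t => V (max t 0)) β := hb
  have huC : u ∈ closure {x : X | 0 ≤ x} := subset_closure hu
  -- rewriting the integrals
  have eV : ∀ n t x, 0 ≤ t → ∫ s in (0:ℝ)..t, Vn n s x = W n t x := by
    intro n t x ht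
    rw [hW, max_eq_left ht]
    refine intervalIntegral.integral_congr fun s hs => ?_
    rw [uIcc_of_le ht] at hs
    simp only [max_eq_left hs.1]
  have eQ : ∀ t, 0 ≤ t → ∫ s in (0:ℝ)..t, V s u = ∫ s in (0:ℝ)..t, V (max s 0) u := by
    intro t ht
    refine intervalIntegral.integral_congr fun s hs => ?_
    rw [uIcc_of_le ht] at hs
    simp only [max_eq_left hs.1]
  have eB : ∀ n t x, 0 ≤ t → B ⟨∫ s in (0:ℝ)..t, Vn n s x, memInt n t x⟩
      = exD A.domain B (W n t x) := by
    intro n t x ht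
    rw [← eV n t x ht, exD_of B (memInt n t x)]
  have ea : ∀ n t x, 0 ≤ t → aFun Ψ A B ⟨∫ s in (0:ℝ)..t, Vn n s x, memInt n t x⟩
      = Core.al A.domain A.toFun B Ψ (W n t x) := by
    intro n t x ht
    rw [Core.al, ← eV n t x ht, exD_of B (memInt n t x), exD_of A.toFun (memInt n t x)]
    rfl
  have i2 : (∀ t : ℝ, 0 < t → Tendsto (fun n : ℕ =>
      ‖B ⟨∫ s in (0:ℝ)..t, Vn n s u, memInt n t u⟩‖) atTop (𝓝 0)) ↔ ∀ t : ℝ, 0 < t → β t u = 0 := by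
    refine forall_congr' fun t => forall_congr' fun ht => ?_
    simp only [fun n => eB n t u ht.le]
    exact h.two_iff hb t huC
  have hat : ∀ t, 0 ≤ t → ahatFun Ψ A B Vn memInt (∫ s in (0:ℝ)..t, V s u)
      = ‖u‖ - ‖V t u‖ - β t u := by
    intro t ht
    rw [eQ t ht]
    have l := h.ahat_lim hb huC ht
    have e : Core.αf Ψ (fun t => V (max t 0)) β t u = ‖u‖ - ‖V t u‖ - β t u := by
      have := h.CΨ _ (h.Qpos t u huC)
      simp only [max_eq_left ht] at this
      simp only [Core.αf, sub_apply, ContinuousLinearMap.comp_apply, max_eq_left ht]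
      rw [this, h.CΨ u huC]
    rw [← e]
    refine Tendsto.limUnder_eq (l.congr' ?_)
    filter_upwards [self_mem_nhdsWithin] with τ hτ
    have hτ : (0:ℝ) < τ := hτ
    simp only [fun n x => ea n τ x hτ.le]
    rw [(hb τ _).2.tsum_eq]
    rfl
  have i1 : (∀ t : ℝ, 0 ≤ t →
      ‖V t u‖ = ‖u‖ - ahatFun Ψ A B Vn memInt (∫ s in (0:ℝ)..t, V s u)) ↔
      ∀ t : ℝ, 0 < t → β t u = 0 := by
    constructor
    · intro h1 t ht
      have := h1 t ht.le
      rw [hat t ht.le] at this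
      linarith
    · intro h1 t ht
      rw [hat t ht]
      have : β t u = 0 := by
        rcases ht.eq_or_lt with rfl | ht
        · refine tendsto_nhds_unique (hb 0 u).1 ?_
          simp only [h.W0, exD_zero, map_zero]
          exact tendsto_const_nhds
        · exact h1 t ht
      rw [this]; ring
  have i3' : ∀ t, 0 < t → (InClosureDomain A B (∫ s in (0:ℝ)..t, V s u) ↔
      ∃ (f : ℕ → X) (w : X), (∀ n, f n ∈ A.domain) ∧
        Tendsto f atTop (𝓝 (∫ s in (0:ℝ)..t, V (max s 0) u)) ∧
        Tendsto (fun n => exD A.domain A.toFun (f n) + exD A.domain B (f n)) atTop (𝓝 w)) := by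
    intro t ht
    rw [eQ t ht.le]
    constructor
    · rintro ⟨f, w, h1, h2⟩
      refine ⟨fun n => f n, w, fun n => (f n).2, h1, h2.congr fun n => ?_⟩
      rw [exD_of _ (f n).2, exD_of _ (f n).2]; rfl
    · rintro ⟨f, w, hf, h1, h2⟩
      refine ⟨fun n => ⟨f n, hf n⟩, w, h1, h2.congr fun n => ?_⟩
      rw [exD_of _ (hf n), exD_of _ (hf n)]; rfl
  have i3 : (∀ t : ℝ, 0 < t → InClosureDomain A B (∫ s in (0:ℝ)..t, V s u)) ↔
      ∀ t : ℝ, 0 < t → β t u = 0 := by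
    refine forall_congr' fun t => forall_congr' fun ht => ?_
    rw [i3' t ht]
    constructor
    · rintro ⟨f, w, hf, h1, h2⟩
      exact h.three_two hb ht.le huC f w hf h1 h2
    · intro h1
      exact h.two_three ht.le huC ((h.two_iff hb t huC).2 h1)
  have i4 : (∀ t : ℝ, 0 < t → IsCompact (closure ((toWeakSpace ℝ X) ''
        (Set.range fun n : ℕ => B ⟨∫ s in (0:ℝ)..t, Vn n s u, memInt n t u⟩)))) ↔
      ∀ t : ℝ, 0 < t → β t u = 0 := by
    refine forall_congr' fun t => forall_congr' fun ht => ?_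
    simp only [fun n => eB n t u ht.le]
    constructor
    · intro h4
      obtain ⟨f, w, hf, h1, h2⟩ := h.four_three ht.le huC h4
      exact h.three_two hb ht.le huC f w hf h1 h2
    · intro h1
      exact Core.two_four ((h.two_iff hb t huC).2 h1)
  exact ⟨i1.trans i2.symm, i2.trans i3.symm, i3.trans i4.symm⟩
end
end
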